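/- Let N ≥ 2, s ∈ (0,1), μ ≥ μ_0, and let Ω ⊂ ℝ^N be a bounded domain with 0 ∈ Ω. Suppose u ∈ W^s_*(Ω) satisfies: E^s_μ(u,v) ≥ 0 for every v ∈ H^s_0(Ω) with v ≥ 0 and v ≡ 0 in a neighborhood of 0; u ≥ 0 a.e. on ℝ^N∖Ω; and liminf_{x→0} u(x)/Φ_μ(x) ≥ 0. Then u ≥ 0 a.e. in ℝ^N. -/

import Mathlib

open MeasureTheory Filter Set Topology Metric

noncomputable section

/-- Euclidean space `ℝ^N`. -/
abbrev EN (N : ℕ) := EuclideanSpace ℝ (Fin N)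

/-- The normalizing constant `C_{N,s}` of the fractional Laplacian. -/
def CNs (N : ℕ) (s : ℝ) : ℝ :=
  2 ^ (2*s) * Real.pi ^ (-(N:ℝ)/2) * s * Real.Gamma ((N + 2*s)/2) / Real.Gamma (1 - s)

/-- The optimal fractional Hardy constant `μ₀`. -/
def mu0 (N : ℕ) (s : ℝ) : ℝ :=
  -(2 ^ (2*s) * Real.Gamma ((N + 2*s)/4) ^ 2 / Real.Gamma ((N - 2*s)/4) ^ 2)

/-- The function `τ ↦ c_s(τ)`. -/
def csFun (N : ℕ) (s τ : ℝ) : ℝ :=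
  2 ^ (2*s) * Real.Gamma ((N + τ)/2) * Real.Gamma ((2*s - τ)/2) /
    (Real.Gamma (-τ/2) * Real.Gamma ((N - 2*s + τ)/2))

/-- `u` has fractional Laplacian `(-Δ)^s u (x) = L` at `x`, as a principal value. -/
def HasFracLap (N : ℕ) (s : ℝ) (u : EN N → ℝ) (x : EN N) (L : ℝ) : Prop :=
  Tendsto (fun ε : ℝ =>
      CNs N s * ∫ z in {z : EN N | ε ≤ dist x z}, (u x - u z) / dist x z ^ ((N:ℝ) + 2*s))
    (𝓝[>] 0) (𝓝 L)

/-- `v` has weighted fractional Laplacian `(-Δ)^s_{Γ_μ} v (x) = L` at `x`, where the weight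
is `Γ_μ(z) = ‖z‖ ^ τp` with `τp = τ₊(s,μ)`. -/
def HasWFracLap (N : ℕ) (s τp : ℝ) (v : EN N → ℝ) (x : EN N) (L : ℝ) : Prop :=
  Tendsto (fun ε : ℝ =>
      CNs N s * ∫ z in {z : EN N | ε ≤ dist x z},
        (v x - v z) * ‖z‖ ^ τp / dist x z ^ ((N:ℝ) + 2*s))
    (𝓝[>] 0) (𝓝 L)

/-- Membership in `L¹(ℝ^N, dx/(1+|x|^{N+2s}))`. -/
def MemL1w (N : ℕ) (s : ℝ) (u : EN N → ℝ) : Prop :=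
  Integrable (fun x : EN N => u x / (1 + ‖x‖ ^ ((N:ℝ) + 2*s)))

/-- Membership in `L^∞_loc(ℝ^N \ {0})`. -/
def LocBddAway (N : ℕ) (u : EN N → ℝ) : Prop :=
  ∀ K : Set (EN N), IsCompact K → (0:EN N) ∉ K → ∃ C : ℝ, ∀ x ∈ K, |u x| ≤ C

/-- Local `θ`-Hölder continuity on compact subsets of `S`, i.e. `C^θ_loc(S)`. -/
def HolderLocOn (N : ℕ) (θ : ℝ) (f : EN N → ℝ) (S : Set (EN N)) : Prop :=
  ∀ K ⊆ S, IsCompact K → ∃ C : ℝ, ∀ x ∈ K, ∀ y ∈ K, |f x - f y| ≤ C * dist x y ^ θ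

/-- Membership in `L^∞_loc(S)`. -/
def LinfLocOn (N : ℕ) (f : EN N → ℝ) (S : Set (EN N)) : Prop :=
  AEMeasurable f ∧ ∀ K ⊆ S, IsCompact K → ∃ C : ℝ, ∀ x ∈ K, |f x| ≤ C

/-- A bounded `C²` domain: open, connected and bounded, whose boundary is the regular zero
level set of a `C²` defining function. -/
structure IsBoundedC2Domain (N : ℕ) (Ω : Set (EN N)) : Prop where
  isOpen : IsOpen Ω
  isConnected : IsConnected Ω
  isBounded : Bornology.IsBounded Ω
  c2Boundary : ∃ φ : EN N → ℝ, ContDiff ℝ 2 φ ∧ Ω = {x | φ x < 0} ∧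
    ∀ x ∈ frontier Ω, fderiv ℝ φ x ≠ 0

/-- A bounded domain: open, connected and bounded. -/
def IsBoundedDomain (N : ℕ) (Ω : Set (EN N)) : Prop :=
  IsOpen Ω ∧ IsConnected Ω ∧ Bornology.IsBounded Ω

/-- The first standard coordinate vector `e₁ ∈ ℝ^N`. -/
def e1 (N : ℕ) : EN N :=
  (EuclideanSpace.equiv (Fin N) ℝ).symm (fun i => if (i:ℕ) = 0 then 1 else 0)

/-- The surface measure `ω_{N-1}` of the unit sphere in `ℝ^N`. -/
def omegaN (N : ℕ) : ℝ := N * (volume (ball (0 : EN N) 1)).toReal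

/-- The normalization constant `c_{s,0}`. -/
def cs0 (N : ℕ) (s : ℝ) : ℝ :=
  CNs N s * omegaN N * ∫ t in Ioo (0:ℝ) 1, ∫ z in ball (0:EN N) t,
    (‖z‖ ^ (2*s - N) - 1) / ‖e1 N - z‖ ^ ((N:ℝ) + 2*s)

/-- The fundamental solution `Φ_μ`, expressed via the exponent `τ = τ₋(s,μ)`:
`Φ_μ(x) = |x|^τ` for `μ ≠ μ₀` and `Φ_{μ₀}(x) = -|x|^τ ln |x|`. -/
def Phi (N : ℕ) (s μ τ : ℝ) (x : EN N) : ℝ :=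
  if μ = mu0 N s then -(‖x‖ ^ τ * Real.log ‖x‖) else ‖x‖ ^ τ

/-- The integrand appearing in the definition of `c_{s,μ}`. -/
def cIntegrand (N : ℕ) (s μ τm τp : ℝ) (z : EN N) : ℝ :=
  if μ = mu0 N s then ‖z‖ ^ ((2*s - N)/2) * (-Real.log ‖z‖) / ‖e1 N - z‖ ^ ((N:ℝ) + 2*s)
  else (‖z‖ ^ τm - ‖z‖ ^ τp) / ‖e1 N - z‖ ^ ((N:ℝ) + 2*s)

/-- The normalization constant `c_{s,μ}`. -/
def csmu (N : ℕ) (s μ τm τp : ℝ) : ℝ :=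
  CNs N s * omegaN N * ∫ t in Ioo (0:ℝ) 1, ∫ z in ball (0:EN N) t, cIntegrand N s μ τm τp z

/-- The weight `Λ_μ`, expressed via `τp = τ₊(s,μ)`. -/
def Lam (N : ℕ) (s τp : ℝ) (x : EN N) : ℝ :=
  if 2*s - 1 < τp then 1
  else if τp < 2*s - 1 then ‖x‖ ^ (1 - 2*s + τp)
  else 1 + max (-Real.log ‖x‖) 0

/-- The quadratic form `E^s(u,v)`. -/
def Es (N : ℕ) (s : ℝ) (u v : EN N → ℝ) : ℝ :=
  (CNs N s / 2) *
    ∫ p : EN N × EN N, (u p.1 - u p.2) * (v p.1 - v p.2) / dist p.1 p.2 ^ ((N:ℝ) + 2*s)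

/-- The quadratic form `E^s_μ(u,v)`. -/
def Esmu (N : ℕ) (s μ : ℝ) (u v : EN N → ℝ) : ℝ :=
  Es N s u v + μ * ∫ x : EN N, u x * v x / ‖x‖ ^ (2*s)

/-- `E^s_{A,B}(u,u) < ∞`. -/
def FiniteEnergyOn (N : ℕ) (s : ℝ) (u : EN N → ℝ) (A B : Set (EN N)) : Prop :=
  IntegrableOn (fun p : EN N × EN N => (u p.1 - u p.2)^2 / dist p.1 p.2 ^ ((N:ℝ) + 2*s)) (A ×ˢ B)

/-- Membership in `H^s(ℝ^N)`: locally `L²` with finite Gagliardo seminorm. -/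
def MemHs (N : ℕ) (s : ℝ) (u : EN N → ℝ) : Prop :=
  (∀ K : Set (EN N), IsCompact K → IntegrableOn (fun x => (u x)^2) K) ∧
  FiniteEnergyOn N s u univ univ

/-- Membership in `H^s_0(Ω)`. -/
def MemHs0 (N : ℕ) (s : ℝ) (Ω : Set (EN N)) (u : EN N → ℝ) : Prop :=
  MemHs N s u ∧ ∀ᵐ x : EN N, x ∉ Ω → u x = 0

/-- Membership in `W^s(Ω)`. -/
def MemWs (N : ℕ) (s : ℝ) (Ω : Set (EN N)) (u : EN N → ℝ) : Prop :=
  MemL1w N s u ∧ IntegrableOn (fun x => (u x)^2) Ω ∧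
  ∃ Ω' : Set (EN N), IsOpen Ω' ∧ IsConnected Ω' ∧ closure Ω ⊆ Ω' ∧ FiniteEnergyOn N s u Ω Ω'

/-- Membership in `W^s_*(Ω)`. -/
def MemWsStar (N : ℕ) (s : ℝ) (Ω : Set (EN N)) (u : EN N → ℝ) : Prop :=
  MemL1w N s u ∧ ∀ ε : ℝ, 0 < ε → MemWs N s (Ω \ closedBall 0 ε) u

/-- The distributional identity `L^s_μ u = f` in `Ω \ {0}`, tested against `C^∞_c(Ω\{0})`. -/
def DistrEq (N : ℕ) (s μ : ℝ) (Ω : Set (EN N)) (f u : EN N → ℝ) : Prop :=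
  ∀ φ : EN N → ℝ, ContDiff ℝ (⊤ : ℕ∞) φ → HasCompactSupport φ → tsupport φ ⊆ Ω \ {0} →
    ∀ g : EN N → ℝ, (∀ x, HasFracLap N s φ x (g x)) →
      (∫ x, u x * g x) + μ * ∫ x, u x * φ x / ‖x‖ ^ (2*s) = ∫ x in Ω, f x * φ x

/-- A distributional solution of `L^s_μ u = f` in `Ω \ {0}` with `u = 0` in `ℝ^N \ Ω`. -/
def IsDistrSol (N : ℕ) (s μ : ℝ) (Ω : Set (EN N)) (f u : EN N → ℝ) : Prop :=
  LocBddAway N u ∧ MemL1w N s u ∧ (∀ x ∉ Ω, u x = 0) ∧ DistrEq N s μ Ω f u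

/-- Inverse-gamma integral. -/
lemma invgamma_integrable {α c : ℝ} (hα : 0 < α) (hc : 0 < c) :
    IntegrableOn (fun σ : ℝ => σ ^ (-α-1) * Real.exp (-c/σ)) (Ioi 0) := by
  have h := (integrableOn_rpow_mul_exp_neg_mul_rpow (p := 1) (s := α - 1) (b := c)
    (by linarith) one_pos hc)
  have h2 := (integrableOn_Ioi_comp_rpow_iff
    (fun t : ℝ => t ^ (α-1) * Real.exp (-c * t ^ (1:ℝ))) (p := -1) (by norm_num)).2 h
  refine h2.congr_fun (fun σ hσ => ?_) measurableSet_Ioi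
  have hσ : 0 < σ := hσ
  simp only [smul_eq_mul, Real.rpow_one, abs_neg, abs_one, one_mul, Real.rpow_neg_one]
  rw [Real.inv_rpow hσ.le, ← Real.rpow_neg hσ.le, ← mul_assoc, ← Real.rpow_add hσ]
  congr 1; ring_nf

lemma invgamma_integral {α c : ℝ} (hα : 0 < α) (hc : 0 < c) :
    ∫ σ in Ioi (0:ℝ), σ ^ (-α-1) * Real.exp (-c/σ) = Real.Gamma α * c ^ (-α) := by
  have h := Real.integral_rpow_mul_exp_neg_mul_Ioi hα hc
  have h2 := integral_comp_rpow_Ioi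
    (fun t : ℝ => t ^ (α-1) * Real.exp (-(c * t))) (p := -1) (by norm_num)
  rw [h] at h2
  rw [mul_comm, Real.rpow_neg hc.le, ← Real.inv_rpow hc.le, ← one_div, ← h2]
  refine setIntegral_congr_fun measurableSet_Ioi (fun σ hσ => ?_)
  have hσ : 0 < σ := hσ
  simp only [smul_eq_mul, abs_neg, abs_one, one_mul, Real.rpow_neg_one]
  rw [Real.inv_rpow hσ.le, ← Real.rpow_neg hσ.le, ← mul_assoc, ← Real.rpow_add hσ]
  congr 1 <;> ring_nf

/-- Heat kernel (unnormalised). -/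
def hk (N : ℕ) (θ : ℝ) (z : EN N) : ℝ := θ ^ (-(N:ℝ)/2) * Real.exp (-‖z‖^2/θ)

lemma hk_nonneg (N : ℕ) {θ : ℝ} (hθ : 0 ≤ θ) (z : EN N) : 0 ≤ hk N θ z := by
  unfold hk; positivity

lemma hk_pos (N : ℕ) {θ : ℝ} (hθ : 0 < θ) (z : EN N) : 0 < hk N θ z := by
  unfold hk; positivity

lemma hk_measurable (N : ℕ) : Measurable (fun p : ℝ × EN N => hk N p.1 p.2) := by
  unfold hk; fun_prop

lemma hk_integrable (N : ℕ) {θ : ℝ} (hθ : 0 < θ) : Integrable (fun z : EN N => hk N θ z) := by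
  have h := GaussianFourier.integrable_cexp_neg_mul_sq_norm_add (V := EN N) (b := ((1/θ : ℝ):ℂ))
    (by simpa using hθ) 0 0
  have h2 := h.norm
  unfold hk
  refine (h2.congr (ae_of_all _ fun z => ?_)).const_mul _
  simp only [Complex.norm_exp, zero_mul, add_zero]
  congr 1
  rw [← Complex.ofReal_pow, ← Complex.ofReal_neg, ← Complex.ofReal_mul, Complex.ofReal_re]
  ring

lemma hk_integral (N : ℕ) {θ : ℝ} (hθ : 0 < θ) :
    ∫ z : EN N, hk N θ z = Real.pi ^ ((N:ℝ)/2) := by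
  have h := GaussianFourier.integral_rexp_neg_mul_sq_norm (V := EN N) (b := 1/θ) (by positivity)
  unfold hk
  rw [integral_const_mul]
  have : ∀ z : EN N, Real.exp (-‖z‖^2/θ) = Real.exp (-(1/θ) * ‖z‖^2) := fun z => by
    congr 1; ring
  simp_rw [this, h]
  rw [finrank_euclideanSpace, Fintype.card_fin, div_div_eq_mul_div, div_one,
    Real.mul_rpow Real.pi_pos.le hθ.le, neg_div, Real.rpow_neg hθ.le]
  field_simp

lemma hk_comp_sub_integrable (N : ℕ) {θ : ℝ} (hθ : 0 < θ) (x : EN N) :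
    Integrable (fun y : EN N => hk N θ (x - y)) :=
  (hk_integrable N hθ).comp_sub_left x

lemma hk_comp_sub_integral (N : ℕ) {θ : ℝ} (hθ : 0 < θ) (x : EN N) :
    ∫ y : EN N, hk N θ (x - y) = Real.pi ^ ((N:ℝ)/2) := by
  rw [integral_sub_left_eq_self (fun z => hk N θ z) volume x, hk_integral N hθ]

lemma hk_sub_comm (N : ℕ) (θ : ℝ) (x y : EN N) : hk N θ (x - y) = hk N θ (y - x) := by
  unfold hk; rw [norm_sub_rev]

/-- Completing the square for a product of two heat kernels. -/
lemma hk_mul (N : ℕ) {θ σ : ℝ} (hθ : 0 < θ) (hσ : 0 < σ) (x y : EN N) :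
    hk N σ y * hk N θ (x - y) =
      hk N (σ + θ) x * hk N (σ*θ/(σ+θ)) ((σ/(σ+θ)) • x - y) := by
  have hst : 0 < σ + θ := by positivity
  unfold hk
  have e : σ ^ (-(N:ℝ)/2) * θ ^ (-(N:ℝ)/2) =
      (σ + θ) ^ (-(N:ℝ)/2) * (σ*θ/(σ+θ)) ^ (-(N:ℝ)/2) := by
    rw [← Real.mul_rpow hσ.le hθ.le, ← Real.mul_rpow hst.le (by positivity)]
    congr 1; field_simp
  have q : -‖y‖^2/σ + -‖x-y‖^2/θ =
      -‖x‖^2/(σ+θ) + -‖(σ/(σ+θ)) • x - y‖^2/(σ*θ/(σ+θ)) := by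
    rw [@norm_sub_sq_real, @norm_sub_sq_real, norm_smul, real_inner_smul_left, mul_pow,
      Real.norm_eq_abs, sq_abs]
    field_simp
    ring
  calc _ = (σ ^ (-(N:ℝ)/2) * θ ^ (-(N:ℝ)/2)) * (Real.exp (-‖y‖^2/σ) * Real.exp (-‖x-y‖^2/θ)) := by ring
    _ = _ := by rw [e, ← Real.exp_add, q, Real.exp_add]; ring

lemma hk_conv_integrable (N : ℕ) {θ σ : ℝ} (hθ : 0 < θ) (hσ : 0 < σ) (x : EN N) :
    Integrable (fun y => hk N σ y * hk N θ (x - y)) := by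
  simp_rw [hk_mul N hθ hσ]
  exact (hk_comp_sub_integrable N (by positivity) _).const_mul _

lemma hk_conv (N : ℕ) {θ σ : ℝ} (hθ : 0 < θ) (hσ : 0 < σ) (x : EN N) :
    ∫ y, hk N σ y * hk N θ (x - y) = Real.pi ^ ((N:ℝ)/2) * hk N (σ + θ) x := by
  simp_rw [hk_mul N hθ hσ]
  rw [integral_const_mul, hk_comp_sub_integral N (by positivity), mul_comm]

/-- The function `φ ↦ 1 - 1_{φ<1} (1-φ)^{p-1}`. -/
def jf (p φ : ℝ) : ℝ := 1 - (if φ < 1 then (1 - φ) ^ (p-1) else 0)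

lemma jf_measurable (p : ℝ) : Measurable (jf p) := by
  unfold jf
  refine measurable_const.sub (Measurable.ite measurableSet_Iio ?_ measurable_const)
  fun_prop

lemma one_sub_rpow_le {p φ : ℝ} (hp : 0 < p) (h0 : 0 ≤ φ) (h1 : φ ≤ 1) :
    1 - (1-φ)^p ≤ max p 1 * φ := by
  rcases le_total 1 p with h | h
  · have := one_add_mul_self_le_rpow_one_add (s := -φ) (by linarith) h
    rw [max_eq_left h, show 1 - φ = 1 + -φ by ring]; linarith
  · rw [max_eq_right h]
    rcases eq_or_lt_of_le h1 with h1 | h1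
    · subst h1; simp [Real.zero_rpow hp.ne']
    have : (1-φ)^(1:ℝ) ≤ (1-φ)^p :=
      Real.rpow_le_rpow_of_exponent_ge (by linarith) (by linarith) h
    rw [Real.rpow_one] at this; linarith

lemma beta_integrable {a b : ℝ} (ha : 0 < a) (hb : 0 < b) :
    IntegrableOn (fun x : ℝ => x^(a-1) * (1-x)^(b-1)) (Ioo 0 1) := by
  have h := (Complex.betaIntegral_convergent (u := a) (v := b) (by simpa) (by simpa))
  rw [intervalIntegrable_iff_integrableOn_Ioo_of_le zero_le_one] at h
  refine (IntegrableOn.congr_fun h.norm (fun x hx => ?_) measurableSet_Ioo)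
  simp only [norm_mul]
  have h1 : (1 - (x:ℂ)) = ((1 - x : ℝ):ℂ) := by push_cast; ring
  rw [h1, Complex.norm_cpow_eq_rpow_re_of_pos hx.1,
    Complex.norm_cpow_eq_rpow_re_of_pos (by linarith [hx.2])]
  simp

lemma beta_integral {a b : ℝ} (ha : 0 < a) (hb : 0 < b) :
    ∫ x in Ioo (0:ℝ) 1, x^(a-1) * (1-x)^(b-1) = Real.Gamma a * Real.Gamma b / Real.Gamma (a+b) := by
  have h := ProbabilityTheory.beta_eq_betaIntegralReal a b ha hb
  unfold ProbabilityTheory.beta at h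
  rw [h, Complex.betaIntegral, intervalIntegral.integral_of_le zero_le_one,
    integral_Ioc_eq_integral_Ioo]
  have : ∀ x ∈ Ioo (0:ℝ) 1, ((x:ℂ) ^ ((a:ℂ) - 1) * (1 - (x:ℂ)) ^ ((b:ℂ) - 1)) =
      ((x^(a-1) * (1-x)^(b-1) : ℝ) : ℂ) := by
    intro x hx
    push_cast
    rw [Complex.ofReal_cpow hx.1.le, Complex.ofReal_cpow (by linarith [hx.2])]
    push_cast; rfl
  rw [setIntegral_congr_fun measurableSet_Ioo this, integral_complex_ofReal, Complex.ofReal_re]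

lemma jA_integrable {s p : ℝ} (hs1 : s < 1) (hp : 0 < p) :
    IntegrableOn (fun φ : ℝ => φ^(-1-s) * (1 - (1-φ)^p)) (Ioo 0 1) := by
  have h : IntegrableOn (fun φ : ℝ => max p 1 * φ^(-s)) (Ioo 0 1) :=
    ((intervalIntegral.integrableOn_Ioo_rpow_iff zero_lt_one).2 (by linarith)).const_mul _
  refine Integrable.mono' h (by fun_prop) ?_
  filter_upwards [ae_restrict_mem measurableSet_Ioo] with φ hφ
  have h1 := one_sub_rpow_le hp hφ.1.le hφ.2.le
  have h2 : (1-φ)^p ≤ 1 := Real.rpow_le_one (by linarith [hφ.2]) (by linarith [hφ.1]) hp.le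
  have h3 : 0 < φ^(-1-s) := Real.rpow_pos_of_pos hφ.1 _
  rw [Real.norm_of_nonneg (mul_nonneg h3.le (by linarith))]
  calc _ ≤ φ^(-1-s) * (max p 1 * φ) := by gcongr
    _ = max p 1 * (φ^(-1-s) * φ^(1:ℝ)) := by rw [Real.rpow_one]; ring
    _ = _ := by rw [← Real.rpow_add hφ.1]; congr 2; ring

lemma jA_integral {s p : ℝ} (hs : 0 < s) (hs1 : s < 1) (hp : 0 < p) :
    ∫ φ in Ioo (0:ℝ) 1, φ^(-1-s) * (1 - (1-φ)^p) =
      -1/s + p/s * (Real.Gamma (1-s) * Real.Gamma p / Real.Gamma (1-s+p)) := by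
  have hA := jA_integrable (s := s) hs1 hp
  have hB := beta_integrable (a := 1-s) (b := p) (by linarith) hp
  have hBi := beta_integral (a := 1-s) (b := p) (by linarith) hp
  rw [← hBi, ← integral_const_mul]
  have key : ∫ φ in (0:ℝ)..1, (φ^(-1-s) * (1 - (1-φ)^p) -
      p/s * (φ^(1-s-1) * (1-φ)^(p-1))) = -1/s - 0 := by
    apply intervalIntegral.integral_eq_sub_of_hasDerivAt_of_tendsto
      (f := fun φ => -φ^(-s)/s * (1 - (1-φ)^p)) zero_lt_one
    · intro φ hφ
      have d1 := (Real.hasDerivAt_rpow_const (x := φ) (p := -s) (Or.inl hφ.1.ne'))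
      have d2 : HasDerivAt (fun φ : ℝ => (1-φ)^p) (-1 * p * (1-φ)^(p-1)) φ :=
        ((hasDerivAt_id φ).const_sub 1).rpow_const (Or.inl (by simp; linarith [hφ.2]))
      have d3 := ((d1.neg).div_const s).mul (d2.const_sub 1)
      refine d3.congr_deriv ?_
      simp only [Pi.neg_apply]
      rw [show -s-1 = -1-s by ring, show 1-s-1 = -s by ring]
      field_simp
      ring
    · rw [intervalIntegrable_iff_integrableOn_Ioo_of_le zero_le_one]
      exact hA.sub (hB.const_mul _)
    · have hb : Tendsto (fun φ : ℝ => (max p 1 / s) * φ^(1-s)) (𝓝[>] 0) (𝓝 0) := by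
        have := (Real.continuousAt_rpow_const 0 (1-s) (Or.inr (by linarith))).tendsto.mono_left
          (nhdsWithin_le_nhds (s := Ioi 0))
        rw [Real.zero_rpow (by linarith)] at this
        simpa using this.const_mul (max p 1 / s)
      refine squeeze_zero_norm' ?_ hb
      filter_upwards [Ioo_mem_nhdsGT zero_lt_one] with φ hφ
      have h1 := one_sub_rpow_le hp hφ.1.le hφ.2.le
      have h2 : (1-φ)^p ≤ 1 := Real.rpow_le_one (by linarith [hφ.2]) (by linarith [hφ.1]) hp.le
      have h3 : 0 < φ^(-s) := Real.rpow_pos_of_pos hφ.1 _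
      rw [norm_mul, norm_div, norm_neg, Real.norm_of_nonneg h3.le, Real.norm_of_nonneg hs.le,
        Real.norm_of_nonneg (by linarith : 0 ≤ 1 - (1-φ)^p)]
      calc _ ≤ φ^(-s)/s * (max p 1 * φ) := by gcongr
        _ = (max p 1/s) * (φ^(-s) * φ^(1:ℝ)) := by rw [Real.rpow_one]; ring
        _ = _ := by rw [← Real.rpow_add hφ.1]; congr 2; ring
    · have c : ContinuousAt (fun φ : ℝ => -φ^(-s)/s * (1 - (1-φ)^p)) 1 := by
        refine ContinuousAt.mul ?_ ?_
        · exact ((Real.continuousAt_rpow_const 1 (-s) (Or.inl one_ne_zero)).neg).div_const s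
        · refine continuousAt_const.sub ?_
          exact ContinuousAt.rpow_const (by fun_prop) (Or.inr hp.le)
      have := c.tendsto.mono_left (nhdsWithin_le_nhds (s := Iio 1))
      simpa [Real.zero_rpow hp.ne'] using this
  rw [intervalIntegral.integral_of_le zero_le_one, integral_Ioc_eq_integral_Ioo,
    integral_sub hA (hB.const_mul _)] at key
  linarith

lemma jf_split {p s φ : ℝ} (hφ : φ ∈ Ioo (0:ℝ) 1) :
    φ^(-1-s) * jf p φ = φ^(-1-s) * (1 - (1-φ)^p) - φ^(1-s-1) * (1-φ)^(p-1) := by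
  unfold jf
  rw [if_pos hφ.2]
  have e : (1-φ)^p = (1-φ) * (1-φ)^(p-1) := by
    rw [mul_comm, ← Real.rpow_add_one (by linarith [hφ.2])]; ring_nf
  have e2 : φ^(1-s-1) = φ^(-1-s) * φ := by
    rw [← Real.rpow_add_one hφ.1.ne']; ring_nf
  rw [e, e2]; ring

lemma jf_integrable {s p : ℝ} (hs : 0 < s) (hs1 : s < 1) (hp : 0 < p) :
    IntegrableOn (fun φ : ℝ => φ^(-1-s) * jf p φ) (Ioi 0) := by
  have h1 : IntegrableOn (fun φ : ℝ => φ^(-1-s) * jf p φ) (Ioo 0 1) :=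
    ((jA_integrable hs1 hp).sub (beta_integrable (a := 1-s) (b := p) (by linarith) hp)).congr_fun
      (fun φ hφ => (jf_split hφ).symm) measurableSet_Ioo
  have h2 : IntegrableOn (fun φ : ℝ => φ^(-1-s) * jf p φ) (Ici 1) := by
    rw [integrableOn_Ici_iff_integrableOn_Ioi]
    refine (integrableOn_Ioi_rpow_of_lt (a := -1-s) (by linarith) one_pos).congr_fun
      (fun φ hφ => ?_) measurableSet_Ioi
    simp [jf, not_lt.2 (le_of_lt (mem_Ioi.1 hφ))]
  rw [← Ioo_union_Ici_eq_Ioi zero_lt_one]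
  exact h1.union h2

lemma jf_integral {s p : ℝ} (hs : 0 < s) (hs1 : s < 1) (hp : 0 < p) :
    ∫ φ in Ioi (0:ℝ), φ^(-1-s) * jf p φ =
      Real.Gamma (1-s) * Real.Gamma p / (s * Real.Gamma (p-s)) := by
  have hI := jf_integrable hs hs1 hp
  rw [← Ioo_union_Ici_eq_Ioi zero_lt_one] at hI ⊢
  rw [setIntegral_union (by rw [Set.disjoint_left]; intro x h1 h2; exact absurd h1.2 (not_lt.2 h2))
    measurableSet_Ici hI.left_of_union hI.right_of_union]
  rw [setIntegral_congr_fun measurableSet_Ioo (fun φ hφ => jf_split hφ),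
    integral_sub (jA_integrable hs1 hp) (beta_integrable (a := 1-s) (b := p) (by linarith) hp),
    jA_integral hs hs1 hp, beta_integral (a := 1-s) (b := p) (by linarith) hp,
    integral_Ici_eq_integral_Ioi]
  rw [setIntegral_congr_fun (g := fun φ : ℝ => φ^(-1-s)) measurableSet_Ioi
    (fun φ hφ => by simp [jf, not_lt.2 (le_of_lt (mem_Ioi.1 hφ))]),
    integral_Ioi_rpow_of_lt (by linarith) one_pos, Real.one_rpow]
  have hG : Real.Gamma (1-s+p) ≠ 0 := (Real.Gamma_pos_of_pos (by linarith)).ne'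
  rcases eq_or_ne (p - s) 0 with h0 | h0
  · rw [h0, Real.Gamma_zero]
    have : p = s := by linarith
    subst this
    have : -1 - p + 1 ≠ 0 := by linarith
    simp only [mul_zero, div_zero]
    rw [div_self hs.ne']; field_simp; ring
  · have e : Real.Gamma (1-s+p) = (p-s) * Real.Gamma (p-s) := by
      rw [← Real.Gamma_add_one h0]; ring_nf
    have hG' : Real.Gamma (p-s) ≠ 0 := by
      intro h; rw [h, mul_zero] at e; exact hG e
    rw [e]
    have : -1 - s + 1 ≠ 0 := by linarith
    have h3 : -(1:ℝ) / (-1-s+1) = 1/s := by rw [show -1-s+1 = -s by ring]; field_simp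
    rw [h3]
    field_simp
    ring

/-- Regularised difference operator `∫ (f x - f y) h_θ(x-y) dy`. -/
def Dop (N : ℕ) (f : EN N → ℝ) (θ : ℝ) (x : EN N) : ℝ :=
  ∫ y, (f x - f y) * hk N θ (x - y)

lemma sig_eq {N : ℕ} {β : ℝ} {y : EN N} {σ : ℝ} (hσ : 0 < σ) :
    σ^(β-1) * hk N σ y = σ ^ (-((N:ℝ)/2-β)-1) * Real.exp (-‖y‖^2/σ) := by
  unfold hk
  rw [← mul_assoc, ← Real.rpow_add hσ]
  congr 2; ring

lemma sig_integrable {N : ℕ} {β : ℝ} (hβ : β < (N:ℝ)/2) {y : EN N} (hy : y ≠ 0) :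
    IntegrableOn (fun σ : ℝ => σ^(β-1) * hk N σ y) (Ioi 0) :=
  (invgamma_integrable (α := (N:ℝ)/2-β) (c := ‖y‖^2) (by linarith)
    (by have := norm_pos_iff.2 hy; positivity)).congr_fun
    (fun _ hσ => (sig_eq hσ).symm) measurableSet_Ioi

lemma sig_integral {N : ℕ} {β : ℝ} (hβ : β < (N:ℝ)/2) {y : EN N} (hy : y ≠ 0) :
    ∫ σ in Ioi (0:ℝ), σ^(β-1) * hk N σ y = Real.Gamma ((N:ℝ)/2-β) * ‖y‖^(2*β-N) := by
  have hy' := norm_pos_iff.2 hy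
  rw [setIntegral_congr_fun measurableSet_Ioi (fun σ hσ => sig_eq hσ),
    invgamma_integral (by linarith) (by positivity)]
  congr 1
  rw [← Real.rpow_natCast, ← Real.rpow_mul hy'.le]
  congr 1; push_cast; ring

lemma shift_integrable {N : ℕ} {p θ : ℝ} (hp : 0 < p) (hpN : p < (N:ℝ)/2) (hθ : 0 < θ) (x : EN N) :
    IntegrableOn (fun σ : ℝ => σ^(p-1) * hk N (σ+θ) x) (Ioi 0) := by
  have hm : Measurable (fun σ : ℝ => σ^(p-1) * hk N (σ+θ) x) := by
    unfold hk; fun_prop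
  have hN : 0 ≤ (N:ℝ)/2 := by linarith
  have hb : ∀ σ : ℝ, 0 < σ → ∀ a : ℝ, 0 < a → a ≤ σ + θ →
      ‖σ^(p-1) * hk N (σ+θ) x‖ ≤ σ^(p-1) * a ^ (-(N:ℝ)/2) := by
    intro σ hσ a ha h
    rw [Real.norm_of_nonneg (mul_nonneg (by positivity) (hk_nonneg N (by positivity) x))]
    gcongr
    unfold hk
    have h1 : Real.exp (-‖x‖^2/(σ+θ)) ≤ 1 := by
      rw [Real.exp_le_one_iff, neg_div]
      have : 0 ≤ ‖x‖^2/(σ+θ) := by positivity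
      linarith
    have h2 : (σ+θ)^(-(N:ℝ)/2) ≤ a^(-(N:ℝ)/2) :=
      Real.rpow_le_rpow_of_nonpos ha h (by linarith)
    calc _ ≤ a^(-(N:ℝ)/2) * 1 := by gcongr
      _ = _ := mul_one _
  rw [← Ioc_union_Ioi_eq_Ioi zero_le_one]
  refine IntegrableOn.union ?_ ?_
  · have : IntegrableOn (fun σ : ℝ => σ^(p-1) * θ^(-(N:ℝ)/2)) (Ioc 0 1) := by
      refine Integrable.mul_const ?_ _
      have := (intervalIntegral.integrableOn_Ioo_rpow_iff (s := p-1) zero_lt_one).2 (by linarith)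
      exact (integrableOn_Ioc_iff_integrableOn_Ioo (by simp)).2 this
    refine Integrable.mono' this hm.aestronglyMeasurable ?_
    filter_upwards [ae_restrict_mem measurableSet_Ioc] with σ hσ
    exact hb σ hσ.1 θ hθ (by linarith [hσ.1])
  · have : IntegrableOn (fun σ : ℝ => σ^(p-1-(N:ℝ)/2)) (Ioi 1) :=
      integrableOn_Ioi_rpow_of_lt (by linarith) one_pos
    refine Integrable.mono' this hm.aestronglyMeasurable ?_
    filter_upwards [ae_restrict_mem measurableSet_Ioi] with σ hσ
    have hσ0 : 0 < σ := lt_trans one_pos hσ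
    refine (hb σ hσ0 σ hσ0 (by linarith)).trans_eq ?_
    rw [← Real.rpow_add hσ0]; congr 1; ring

lemma pow_prod_integrable {N : ℕ} {τ θ : ℝ} (h1 : -(N:ℝ) < τ) (h2 : τ < 0) (hθ : 0 < θ) (x : EN N) :
    Integrable (fun q : EN N × ℝ => q.2^(((N:ℝ)+τ)/2-1) * (hk N q.2 q.1 * hk N θ (x - q.1)))
      (volume.prod (volume.restrict (Ioi 0))) := by
  have hm : Measurable (fun q : EN N × ℝ =>
      q.2^(((N:ℝ)+τ)/2-1) * (hk N q.2 q.1 * hk N θ (x - q.1))) := by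
    unfold hk; fun_prop
  rw [integrable_prod_iff' hm.aestronglyMeasurable]
  constructor
  · filter_upwards [ae_restrict_mem measurableSet_Ioi] with σ hσ
    exact (hk_conv_integrable N hθ hσ x).const_mul _
  · refine ((shift_integrable (p := ((N:ℝ)+τ)/2) (by linarith) (by linarith) hθ x).const_mul
      (Real.pi^((N:ℝ)/2))).congr ?_
    filter_upwards [ae_restrict_mem measurableSet_Ioi] with σ hσ
    have hσ : 0 < σ := hσ
    have : ∀ y : EN N, ‖σ^(((N:ℝ)+τ)/2-1) * (hk N σ y * hk N θ (x - y))‖ =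
        σ^(((N:ℝ)+τ)/2-1) * (hk N σ y * hk N θ (x - y)) := fun y =>
      Real.norm_of_nonneg (mul_nonneg (by positivity)
        (mul_nonneg (hk_nonneg N hσ.le y) (hk_nonneg N hθ.le _)))
    simp_rw [this]
    rw [integral_const_mul, hk_conv N hθ hσ]
    ring

lemma ae_ne_zero_EN {N : ℕ} (hN : 2 ≤ N) : ∀ᵐ y : EN N, y ≠ 0 := by
  haveI : Nontrivial (EN N) := by
    haveI : Nonempty (Fin N) := ⟨⟨0, by omega⟩⟩
    infer_instance
  have := (measure_singleton (μ := (volume : Measure (EN N))) 0)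
  exact compl_mem_ae_iff.2 this

lemma pow_sec {N : ℕ} {τ θ : ℝ} (h2 : τ < 0) (x y : EN N) (hy : y ≠ 0) :
    ∫ σ in Ioi (0:ℝ), σ^(((N:ℝ)+τ)/2-1) * (hk N σ y * hk N θ (x - y)) =
      Real.Gamma (-τ/2) * (‖y‖^τ * hk N θ (x-y)) := by
  simp_rw [← mul_assoc]
  rw [integral_mul_const, sig_integral (by linarith) hy]
  congr 3 <;> ring_nf

lemma pow_hk_integrable {N : ℕ} (hN : 2 ≤ N) {τ θ : ℝ} (h1 : -(N:ℝ) < τ) (h2 : τ < 0) (hθ : 0 < θ)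
    (x : EN N) : Integrable (fun y : EN N => ‖y‖^τ * hk N θ (x-y)) := by
  have hG : Real.Gamma (-τ/2) ≠ 0 := (Real.Gamma_pos_of_pos (by linarith)).ne'
  have h := (pow_prod_integrable h1 h2 hθ x).integral_prod_left
  have h' := (h.congr (g := fun y => Real.Gamma (-τ/2) * (‖y‖^τ * hk N θ (x-y))) (by
    filter_upwards [ae_ne_zero_EN hN] with y hy
    exact pow_sec h2 x y hy))
  refine (h'.const_mul (Real.Gamma (-τ/2))⁻¹).congr (ae_of_all _ fun y => ?_)
  simp only
  rw [← mul_assoc, inv_mul_cancel₀ hG, one_mul]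

lemma pow_hk_integral {N : ℕ} (hN : 2 ≤ N) {τ θ : ℝ} (h1 : -(N:ℝ) < τ) (h2 : τ < 0) (hθ : 0 < θ)
    (x : EN N) : Real.Gamma (-τ/2) * ∫ y : EN N, ‖y‖^τ * hk N θ (x-y) =
      Real.pi^((N:ℝ)/2) * ∫ σ in Ioi (0:ℝ), σ^(((N:ℝ)+τ)/2-1) * hk N (σ+θ) x := by
  have h := pow_prod_integrable h1 h2 hθ x
  have e1 := integral_prod _ h
  have e2 := integral_prod_symm _ h
  rw [e1] at e2
  rw [← integral_const_mul, ← integral_const_mul]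
  refine Eq.trans ?_ (e2.trans ?_)
  · refine integral_congr_ae ?_
    filter_upwards [ae_ne_zero_EN hN] with y hy
    exact (pow_sec h2 x y hy).symm
  · refine setIntegral_congr_fun measurableSet_Ioi fun σ hσ => ?_
    simp only
    rw [integral_const_mul, hk_conv N hθ hσ]; ring

lemma shift_integral {N : ℕ} {p θ : ℝ} (hθ : 0 < θ) (x : EN N) :
    ∫ σ in Ioi (0:ℝ), σ^(p-1) * hk N (σ+θ) x =
      ∫ σ in Ioi (0:ℝ), (if θ < σ then (σ-θ)^(p-1) * hk N σ x else 0) := by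
  rw [← integral_indicator measurableSet_Ioi, ← integral_indicator measurableSet_Ioi,
    ← integral_sub_right_eq_self _ θ]
  congr 1
  ext σ
  simp only [indicator, mem_Ioi, sub_pos, sub_add_cancel]
  split_ifs with a b
  · rfl
  · linarith
  all_goals rfl

lemma shift_integrable' {N : ℕ} {p θ : ℝ} (hp : 0 < p) (hpN : p < (N:ℝ)/2) (hθ : 0 < θ) (x : EN N) :
    IntegrableOn (fun σ : ℝ => if θ < σ then (σ-θ)^(p-1) * hk N σ x else 0) (Ioi 0) := by
  have h := shift_integrable hp hpN hθ x
  rw [← integrable_indicator_iff measurableSet_Ioi] at h ⊢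
  refine (h.comp_sub_right θ).congr (ae_of_all _ fun σ => ?_)
  simp only [indicator, mem_Ioi, sub_pos, sub_add_cancel]
  split_ifs with a b
  · rfl
  · linarith
  all_goals rfl

lemma jf_scale {p θ σ : ℝ} (hσ : 0 < σ) (a : ℝ) :
    a * (σ^(p-1) * jf p (θ/σ)) = σ^(p-1) * a - if θ < σ then (σ-θ)^(p-1) * a else 0 := by
  unfold jf
  by_cases h : θ < σ
  · rw [if_pos h, if_pos ((div_lt_one hσ).2 h)]
    have : σ^(p-1) * (1-θ/σ)^(p-1) = (σ-θ)^(p-1) := by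
      rw [← Real.mul_rpow hσ.le (by rw [sub_nonneg, div_le_one hσ]; exact h.le)]
      congr 1; field_simp
    rw [← this]; ring
  · rw [if_neg h, if_neg (by rw [div_lt_one hσ]; exact h)]; ring

lemma Dop_eq {N : ℕ} {f : EN N → ℝ} {θ : ℝ} (hθ : 0 < θ) {x : EN N}
    (hf : Integrable (fun y => f y * hk N θ (x - y))) :
    Dop N f θ x = Real.pi^((N:ℝ)/2) * f x - ∫ y, f y * hk N θ (x - y) := by
  unfold Dop
  simp_rw [sub_mul]
  rw [integral_sub ((hk_comp_sub_integrable N hθ x).const_mul _) hf, integral_const_mul,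
    hk_comp_sub_integral N hθ, mul_comm]

lemma Dop_pow {N : ℕ} (hN : 2 ≤ N) {τ θ : ℝ} (h1 : -(N:ℝ) < τ) (h2 : τ < 0) (hθ : 0 < θ)
    {x : EN N} (hx : x ≠ 0) :
    Dop N (fun y => ‖y‖^τ) θ x = Real.pi^((N:ℝ)/2) / Real.Gamma (-τ/2) *
      ∫ σ in Ioi (0:ℝ), hk N σ x * (σ^(((N:ℝ)+τ)/2-1) * jf (((N:ℝ)+τ)/2) (θ/σ)) := by
  have hG : Real.Gamma (-τ/2) ≠ 0 := (Real.Gamma_pos_of_pos (by linarith)).ne'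
  have hpN : ((N:ℝ)+τ)/2 < (N:ℝ)/2 := by linarith
  rw [Dop_eq hθ (pow_hk_integrable hN h1 h2 hθ x)]
  rw [setIntegral_congr_fun measurableSet_Ioi (fun σ hσ => jf_scale hσ (hk N σ x)),
    integral_sub (sig_integrable hpN hx) (shift_integrable' (by linarith) hpN hθ x),
    sig_integral hpN hx, ← shift_integral hθ x]
  have h := pow_hk_integral hN h1 h2 hθ x
  have e : Real.Gamma ((N:ℝ)/2 - ((N:ℝ)+τ)/2) = Real.Gamma (-τ/2) := by congr 1; ring
  rw [e, show 2*(((N:ℝ)+τ)/2)-N = τ by ring]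
  generalize (∫ σ in Ioi (0:ℝ), σ^(((N:ℝ)+τ)/2-1) * hk N (σ+θ) x) = I1 at *
  generalize (∫ y : EN N, ‖y‖^τ * hk N θ (x-y)) = I2 at *
  generalize Real.Gamma (-τ/2) = G at *
  generalize ‖x‖^τ = X at *
  generalize Real.pi^((N:ℝ)/2) = q at *
  rw [div_mul_eq_mul_div, eq_div_iff hG]
  linear_combination -h

lemma theta_scale {s p σ : ℝ} (hσ : 0 < σ) {θ : ℝ} (hθ : 0 < θ) :
    θ^(-1-s) * jf p (θ/σ) = σ^(-1-s) * ((σ⁻¹*θ)^(-1-s) * jf p (σ⁻¹*θ)) := by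
  rw [← mul_assoc, ← Real.mul_rpow hσ.le (by positivity), ← mul_assoc, mul_inv_cancel₀ hσ.ne',
    one_mul, div_eq_inv_mul]

lemma theta_integrable {s p σ : ℝ} (hs : 0 < s) (hs1 : s < 1) (hp : 0 < p) (hσ : 0 < σ) :
    IntegrableOn (fun θ : ℝ => θ^(-1-s) * jf p (θ/σ)) (Ioi 0) := by
  have h := jf_integrable hs hs1 hp
  have h' := (integrableOn_Ioi_comp_mul_left_iff (fun φ : ℝ => φ^(-1-s) * jf p φ) 0
    (inv_pos.2 hσ)).2 (by simpa using h)
  exact IntegrableOn.congr_fun (h'.const_mul (σ^(-1-s))) (fun θ hθ => (theta_scale hσ hθ).symm) measurableSet_Ioi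

lemma theta_integral {s p σ : ℝ} (hσ : 0 < σ) (G : ℝ → ℝ) (hG : ∀ a b : ℝ, 0 ≤ a → G (a*b) = a * G b) :
    ∫ θ in Ioi (0:ℝ), G (θ^(-1-s) * jf p (θ/σ)) =
      σ^(-s) * ∫ φ in Ioi (0:ℝ), G (φ^(-1-s) * jf p φ) := by
  have e : ∀ θ ∈ Ioi (0:ℝ), G (θ^(-1-s) * jf p (θ/σ)) =
      σ^(-1-s) * G ((σ⁻¹*θ)^(-1-s) * jf p (σ⁻¹*θ)) := fun θ hθ => by
    rw [theta_scale hσ hθ, hG _ _ (by positivity)]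
  rw [setIntegral_congr_fun measurableSet_Ioi e, integral_const_mul,
    integral_comp_mul_left_Ioi (fun φ => G (φ^(-1-s) * jf p φ)) 0 (inv_pos.2 hσ)]
  rw [mul_zero, inv_inv, smul_eq_mul, ← mul_assoc, ← Real.rpow_add_one hσ.ne']
  congr 2; ring

def powF (N : ℕ) (s p : ℝ) (x : EN N) (q : ℝ × ℝ) : ℝ :=
  q.1^(-1-s) * (hk N q.2 x * (q.2^(p-1) * jf p (q.1/q.2)))

lemma powF_eq {N : ℕ} {s p : ℝ} {x : EN N} (θ σ : ℝ) :
    powF N s p x (θ, σ) = (σ^(p-1) * hk N σ x) * (θ^(-1-s) * jf p (θ/σ)) := by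
  simp only [powF]; ring

lemma powF_measurable {N : ℕ} {s p : ℝ} {x : EN N} : Measurable (powF N s p x) := by
  have := jf_measurable p
  unfold powF hk; fun_prop

lemma powF_norm {N : ℕ} {s p : ℝ} {x : EN N} {σ : ℝ} (hσ : 0 < σ) :
    ∫ θ in Ioi (0:ℝ), |powF N s p x (θ, σ)| =
      (∫ φ in Ioi (0:ℝ), |φ^(-1-s) * jf p φ|) * (σ^(p-s-1) * hk N σ x) := by
  have : ∀ θ : ℝ, |powF N s p x (θ, σ)| = (σ^(p-1) * hk N σ x) * |θ^(-1-s) * jf p (θ/σ)| := by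
    intro θ
    rw [powF_eq, abs_mul, abs_of_nonneg (a := σ^(p-1) * hk N σ x)
      (mul_nonneg (by positivity) (hk_nonneg N hσ.le x))]
  simp_rw [this]
  rw [integral_const_mul, theta_integral hσ abs (fun a b ha => by rw [abs_mul, abs_of_nonneg ha])]
  have : σ^(p-s-1) = σ^(p-1) * σ^(-s) := by rw [← Real.rpow_add hσ]; congr 1; ring
  rw [this]; ring

lemma powF_integral_theta {N : ℕ} {s p : ℝ} {x : EN N} {σ : ℝ} (hσ : 0 < σ) :
    ∫ θ in Ioi (0:ℝ), powF N s p x (θ, σ) =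
      (∫ φ in Ioi (0:ℝ), φ^(-1-s) * jf p φ) * (σ^(p-s-1) * hk N σ x) := by
  simp_rw [powF_eq]
  have h0 := theta_integral (s := s) (p := p) hσ (fun a => a) (fun a b ha => rfl)
  rw [integral_const_mul, h0]
  have : σ^(p-s-1) = σ^(p-1) * σ^(-s) := by rw [← Real.rpow_add hσ]; congr 1; ring
  rw [this]; ring

lemma powF_integrable {N : ℕ} {s p : ℝ} (hs : 0 < s) (hs1 : s < 1) (hp : 0 < p) (hpN : p < (N:ℝ)/2)
    {x : EN N} (hx : x ≠ 0) :
    Integrable (powF N s p x) ((volume.restrict (Ioi 0)).prod (volume.restrict (Ioi 0))) := by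
  rw [integrable_prod_iff' powF_measurable.aestronglyMeasurable]
  constructor
  · filter_upwards [ae_restrict_mem measurableSet_Ioi] with σ hσ
    simp_rw [powF_eq]
    exact (theta_integrable hs hs1 hp hσ).const_mul _
  · refine ((sig_integrable (N := N) (β := p-s) (by linarith) hx).const_mul
      (∫ φ in Ioi (0:ℝ), |φ^(-1-s) * jf p φ|)).congr ?_
    filter_upwards [ae_restrict_mem measurableSet_Ioi] with σ hσ
    simp only [Real.norm_eq_abs]
    rw [powF_norm hσ]

lemma powD_eq {N : ℕ} (hN : 2 ≤ N) {s τ θ : ℝ} (h1 : -(N:ℝ) < τ) (h2 : τ < 0) (hθ : 0 < θ)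
    {x : EN N} (hx : x ≠ 0) :
    θ^(-1-s) * Dop N (fun y => ‖y‖^τ) θ x = Real.pi^((N:ℝ)/2) / Real.Gamma (-τ/2) *
      ∫ σ in Ioi (0:ℝ), powF N s (((N:ℝ)+τ)/2) x (θ, σ) := by
  rw [Dop_pow hN h1 h2 hθ hx]
  simp only [powF]
  rw [integral_const_mul]; ring

lemma powD_integrable {N : ℕ} (hN : 2 ≤ N) {s τ : ℝ} (hs : 0 < s) (hs1 : s < 1)
    (h1 : -(N:ℝ) < τ) (h2 : τ < 0) {x : EN N} (hx : x ≠ 0) :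
    IntegrableOn (fun θ => θ^(-1-s) * Dop N (fun y => ‖y‖^τ) θ x) (Ioi 0) := by
  have h := (powF_integrable (p := ((N:ℝ)+τ)/2) hs hs1 (by linarith) (by linarith) hx).integral_prod_left
  exact IntegrableOn.congr_fun (h.const_mul (Real.pi^((N:ℝ)/2) / Real.Gamma (-τ/2)))
    (fun θ hθ => (powD_eq hN h1 h2 hθ hx).symm) measurableSet_Ioi

lemma powD_integral {N : ℕ} (hN : 2 ≤ N) {s τ : ℝ} (hs : 0 < s) (hs1 : s < 1)
    (h1 : -(N:ℝ) < τ) (h2 : τ < 0) {x : EN N} (hx : x ≠ 0) :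
    CNs N s / Real.Gamma ((N:ℝ)/2+s) * ∫ θ in Ioi (0:ℝ), θ^(-1-s) * Dop N (fun y => ‖y‖^τ) θ x
     = csFun N s τ * ‖x‖^(τ-2*s) := by
  have h := powF_integrable (p := ((N:ℝ)+τ)/2) hs hs1 (by linarith) (by linarith) hx
  rw [setIntegral_congr_fun measurableSet_Ioi (fun θ hθ => powD_eq hN h1 h2 hθ hx),
    integral_const_mul, integral_integral_swap (f := fun θ σ => powF N s (((N:ℝ)+τ)/2) x (θ, σ)) h,
    setIntegral_congr_fun measurableSet_Ioi (fun σ hσ => powF_integral_theta hσ),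
    integral_const_mul, sig_integral (by linarith) hx, jf_integral hs hs1 (by linarith)]
  have hG1 : Real.Gamma (1-s) ≠ 0 := (Real.Gamma_pos_of_pos (by linarith)).ne'
  have hG2 : Real.Gamma ((N:ℝ)/2+s) ≠ 0 := (Real.Gamma_pos_of_pos (by positivity)).ne'
  unfold CNs csFun
  rw [show ((N:ℝ)+2*s)/2 = (N:ℝ)/2+s by ring, show ((N:ℝ)-2*s+τ)/2 = ((N:ℝ)+τ)/2-s by ring,
    show (2*s-τ)/2 = (N:ℝ)/2 - (((N:ℝ)+τ)/2-s) by ring,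
    show 2*(((N:ℝ)+τ)/2-s)-N = τ - 2*s by ring]
  have hpi : Real.pi^(-(N:ℝ)/2) * Real.pi^((N:ℝ)/2) = 1 := by
    rw [← Real.rpow_add Real.pi_pos, neg_div, neg_add_cancel, Real.rpow_zero]
  generalize Real.pi^(-(N:ℝ)/2) = a at *
  generalize Real.pi^((N:ℝ)/2) = b at *
  generalize Real.Gamma (1-s) = G1 at *
  generalize Real.Gamma ((N:ℝ)/2+s) = G2 at *
  generalize Real.Gamma (((N:ℝ)+τ)/2) = G3 at *
  generalize Real.Gamma (((N:ℝ)+τ)/2-s) = G4 at *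
  generalize Real.Gamma ((N:ℝ)/2 - (((N:ℝ)+τ)/2-s)) = G5 at *
  generalize Real.Gamma (-τ/2) = G6 at *
  generalize ‖x‖^(τ-2*s) = X at *
  generalize (2:ℝ)^(2*s) = T at *
  have e : T * a * s * G2 / G1 / G2 * (b / G6 * (G1 * G3 / (s * G4) * (G5 * X))) =
     (a * b) * ((G2 / G2) * (G1/G1) * (s/s)) * (T * G3 * G5 / (G6 * G4) * X) := by
    simp only [div_eq_mul_inv, mul_inv]; ring
  rw [e, hpi, div_self hG1, div_self hG2, div_self hs.ne']; ring

lemma powD_abs {N : ℕ} (hN : 2 ≤ N) {s τ : ℝ} (hs : 0 < s) (hs1 : s < 1)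
    (h1 : -(N:ℝ) < τ) (h2 : τ < 0) : ∃ C : ℝ, ∀ x : EN N, x ≠ 0 →
    ∫ θ in Ioi (0:ℝ), |θ^(-1-s) * Dop N (fun y => ‖y‖^τ) θ x| ≤ C * ‖x‖^(τ-2*s) := by
  refine ⟨Real.pi^((N:ℝ)/2) / Real.Gamma (-τ/2) *
    ((∫ φ in Ioi (0:ℝ), |φ^(-1-s) * jf (((N:ℝ)+τ)/2) φ|) *
      Real.Gamma ((N:ℝ)/2-(((N:ℝ)+τ)/2-s))), fun x hx => ?_⟩
  have h := powF_integrable (p := ((N:ℝ)+τ)/2) hs hs1 (by linarith) (by linarith) hx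
  have hG : 0 < Real.Gamma (-τ/2) := Real.Gamma_pos_of_pos (by linarith)
  have hle : ∀ θ ∈ Ioi (0:ℝ), |θ^(-1-s) * Dop N (fun y => ‖y‖^τ) θ x| ≤
      Real.pi^((N:ℝ)/2) / Real.Gamma (-τ/2) *
      ∫ σ in Ioi (0:ℝ), |powF N s (((N:ℝ)+τ)/2) x (θ, σ)| := by
    intro θ hθ
    rw [powD_eq hN h1 h2 hθ hx, abs_mul, abs_of_nonneg (by positivity)]
    gcongr
    exact abs_integral_le_integral_abs
  have hi := (powD_integrable hN hs hs1 h1 h2 hx).abs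
  refine (setIntegral_mono_on hi (h.abs.integral_prod_left.const_mul _) measurableSet_Ioi hle).trans
    (le_of_eq ?_)
  rw [integral_const_mul, integral_integral_swap
      (f := fun θ σ => |powF N s (((N:ℝ)+τ)/2) x (θ, σ)|) h.abs,
    setIntegral_congr_fun measurableSet_Ioi (fun σ hσ => powF_norm hσ),
    integral_const_mul, sig_integral (by linarith) hx,
    show 2*(((N:ℝ)+τ)/2-s)-N = τ - 2*s by ring]
  ring

def Jg (s p : ℝ) : ℝ := ∫ φ in Ioi (0:ℝ), φ^(-1-s) * jf p φ

lemma Jg_eq {s p : ℝ} (hs : 0 < s) (hs1 : s < 1) (hp : 0 < p) :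
    Jg s p = Real.Gamma (1-s) * Real.Gamma p / (s * Real.Gamma (p-s)) := jf_integral hs hs1 hp

lemma Jg_concave {s m δ : ℝ} (hs : 0 < s) (hs1 : s < 1) (hδ : 0 < δ) (hm : 0 < m - δ) :
    Jg s (m+δ) + Jg s (m-δ) < 2 * Jg s m := by
  have i1 := jf_integrable hs hs1 (p := m+δ) (by linarith)
  have i2 := jf_integrable hs hs1 hm
  have i3 := jf_integrable hs hs1 (p := m) (by linarith)
  set D : ℝ → ℝ := fun φ => 2 * (φ^(-1-s) * jf m φ) - (φ^(-1-s) * jf (m+δ) φ + φ^(-1-s) * jf (m-δ) φ) with hD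
  have hDi : IntegrableOn D (Ioi 0) := (i3.const_mul 2).sub (i1.add i2)
  have hDint : ∫ φ in Ioi (0:ℝ), D φ = 2 * Jg s m - (Jg s (m+δ) + Jg s (m-δ)) := by
    refine (integral_sub (i3.const_mul 2) (i1.add i2)).trans ?_
    rw [integral_const_mul]
    exact congrArg (fun z => 2 * Jg s m - z) (integral_add i1 i2)
  have key : ∀ φ : ℝ, 0 < φ → φ < 1 → 0 < D φ := by
    intro φ h0 h1
    have ha : 0 < 1 - φ := by linarith
    have e : D φ = φ^(-1-s) * ((1-φ)^(m-δ-1) * ((1-φ)^δ - 1)^2) := by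
      have e1 : (1-φ)^(m+δ-1) = (1-φ)^(m-δ-1) * ((1-φ)^δ * (1-φ)^δ) := by
        rw [← Real.rpow_add ha, ← Real.rpow_add ha]; congr 1; ring
      have e2 : (1-φ)^(m-1) = (1-φ)^(m-δ-1) * (1-φ)^δ := by
        rw [← Real.rpow_add ha]; congr 1; ring
      simp only [hD, jf, if_pos h1, e1, e2]; ring
    rw [e]
    have : (1-φ)^δ < 1 := Real.rpow_lt_one ha.le (by linarith) hδ
    have : 0 < ((1-φ)^δ - 1)^2 := by
      have : (1-φ)^δ - 1 ≠ 0 := by linarith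
      positivity
    positivity
  have hnn : 0 ≤ᵐ[volume.restrict (Ioi 0)] D := by
    filter_upwards [ae_restrict_mem measurableSet_Ioi] with φ hφ
    by_cases h : φ < 1
    · exact (key φ hφ h).le
    · simp only [hD, jf, if_neg h]; simp only [Pi.zero_apply]; linarith
  have hpos : 0 < ∫ φ in Ioi (0:ℝ), D φ := by
    rw [setIntegral_pos_iff_support_of_nonneg_ae hnn hDi]
    have : Ioo (0:ℝ) 1 ⊆ Function.support D ∩ Ioi 0 := fun φ hφ =>
      ⟨(key φ hφ.1 hφ.2).ne', hφ.1⟩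
    refine lt_of_lt_of_le ?_ (measure_mono this)
    simp
  linarith

lemma Jg_pos {s p : ℝ} (hs : 0 < s) (hs1 : s < 1) (hp : s < p) : 0 < Jg s p := by
  rw [Jg_eq hs hs1 (by linarith)]
  have := Real.Gamma_pos_of_pos (show 0 < 1 - s by linarith)
  have := Real.Gamma_pos_of_pos (show 0 < p by linarith)
  have := Real.Gamma_pos_of_pos (show 0 < p - s by linarith)
  positivity

lemma csFun_eq {N : ℕ} {s τ : ℝ} (hs : 0 < s) (hs1 : s < 1) (h1 : -(N:ℝ) < τ) (h2 : τ < 2*s) :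
    csFun N s τ = 2^(2*s) * (s / Real.Gamma (1-s))^2 * (Jg s (((N:ℝ)+τ)/2) * Jg s (s-τ/2)) := by
  have hG1 : Real.Gamma (1-s) ≠ 0 := (Real.Gamma_pos_of_pos (by linarith)).ne'
  rw [Jg_eq hs hs1 (by linarith), Jg_eq hs hs1 (by linarith)]
  unfold csFun
  rw [show ((N:ℝ)-2*s+τ)/2 = ((N:ℝ)+τ)/2-s by ring, show (2*s-τ)/2 = s-τ/2 by ring,
   show s-τ/2-s = -τ/2 by ring]
  generalize Real.Gamma (1-s) = G1 at *
  generalize Real.Gamma (((N:ℝ)+τ)/2) = G3 at *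
  generalize Real.Gamma (((N:ℝ)+τ)/2-s) = G4 at *
  generalize Real.Gamma (s-τ/2) = G5 at *
  generalize Real.Gamma (-τ/2) = G6 at *
  generalize (2:ℝ)^(2*s) = T at *
  have e : T * (s/G1)^2 * (G1 * G3/(s * G4) * (G1 * G5/(s * G6))) =
     ((G1/G1)^2 * (s/s)^2) * (T * G3 * G5 / (G6 * G4)) := by
    simp only [div_eq_mul_inv, mul_inv]; ring
  rw [e, div_self hG1, div_self hs.ne']; ring

lemma csFun_tau0 {N : ℕ} {s : ℝ} (hs : 0 < s) :
    csFun N s ((2*s-N)/2) = -mu0 N s := by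
  unfold csFun mu0
  rw [show ((N:ℝ)+(2*s-N)/2)/2 = (N+2*s)/4 by ring, show (2*s-(2*s-(N:ℝ))/2)/2 = (N+2*s)/4 by ring,
    show -((2*s-(N:ℝ))/2)/2 = (N-2*s)/4 by ring, show ((N:ℝ)-2*s+(2*s-N)/2)/2 = (N-2*s)/4 by ring]
  ring

lemma Jprod_lt {s m δ : ℝ} (hs : 0 < s) (hs1 : s < 1) (hsm : s < m) (hδ : 0 < δ) (hm : 0 < m - δ) :
    Jg s (m+δ) * Jg s (m-δ) < Jg s m * Jg s m := by
  have h := Jg_concave hs hs1 hδ hm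
  have h1 := Jg_pos hs hs1 (p := m+δ) (by linarith)
  have h2 := Jg_pos hs hs1 hsm
  rcases le_or_gt (Jg s (m-δ)) 0 with h3 | h3
  · nlinarith
  · nlinarith [sq_nonneg (Jg s (m+δ) - Jg s (m-δ))]

lemma csFun_lt {N : ℕ} (hN : 2 ≤ N) {s τ : ℝ} (hs : 0 < s) (hs1 : s < 1) (h1 : -(N:ℝ) < τ)
    (h2 : τ < 2*s) (hne : τ ≠ (2*s-N)/2) : csFun N s τ < csFun N s ((2*s-N)/2) := by
  have hN' : (2:ℝ) ≤ N := by exact_mod_cast hN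
  rw [csFun_eq hs hs1 h1 h2, csFun_eq hs hs1 (by linarith) (by linarith)]
  have hG1 : 0 < Real.Gamma (1-s) := (Real.Gamma_pos_of_pos (by linarith))
  refine mul_lt_mul_of_pos_left ?_ (by positivity)
  set m : ℝ := (N+2*s)/4 with hm
  rw [show ((N:ℝ)+(2*s-N)/2)/2 = m by rw [hm]; ring, show s-(2*s-(N:ℝ))/2/2 = m by rw [hm]; ring]
  rcases lt_or_gt_of_ne hne with h | h
  · have := Jprod_lt (δ := s - τ/2 - m) (m := m) hs hs1 (by rw [hm]; linarith) (by rw [hm]; linarith)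
      (by rw [hm]; linarith)
    rw [show m + (s-τ/2-m) = s-τ/2 by ring, show m - (s-τ/2-m) = ((N:ℝ)+τ)/2 by rw [hm]; ring] at this
    linarith
  · have := Jprod_lt (δ := ((N:ℝ)+τ)/2 - m) (m := m) hs hs1 (by rw [hm]; linarith) (by rw [hm]; linarith)
      (by rw [hm]; linarith)
    rw [show m + (((N:ℝ)+τ)/2-m) = ((N:ℝ)+τ)/2 by ring, show m - (((N:ℝ)+τ)/2-m) = s-τ/2 by rw [hm]; ring] at this
    linarith

lemma csFun_deriv {N : ℕ} (hN : 2 ≤ N) {s : ℝ} (hs : 0 < s) (hs1 : s < 1) :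
    HasDerivAt (csFun N s) 0 ((2*s-N)/2) := by
  have hN' : (2:ℝ) ≤ N := by exact_mod_cast hN
  set t : ℝ := (2*s-N)/2 with ht
  have hd : DifferentiableAt ℝ (csFun N s) t := by
    have hg : ∀ a : ℝ, 0 < a → DifferentiableAt ℝ Real.Gamma a := fun a ha =>
      Real.differentiableAt_Gamma (fun k => by
        have : (0:ℝ) ≤ k := k.cast_nonneg
        linarith)
    have hc : ∀ f : ℝ → ℝ, DifferentiableAt ℝ f t → 0 < f t →
      DifferentiableAt ℝ (fun x => Real.Gamma (f x)) t := fun f hf h => (hg _ h).comp t hf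
    unfold csFun
    refine DifferentiableAt.div ?_ ?_ ?_
    · refine DifferentiableAt.mul (DifferentiableAt.mul (by fun_prop) ?_) ?_
      · exact hc (fun τ => ((N:ℝ)+τ)/2) (by fun_prop) (by simp only [ht]; linarith)
      · exact hc (fun τ => (2*s-τ)/2) (by fun_prop) (by simp only [ht]; linarith)
    · refine DifferentiableAt.mul ?_ ?_
      · exact hc (fun τ => -τ/2) (by fun_prop) (by simp only [ht]; linarith)
      · exact hc (fun τ => ((N:ℝ)-2*s+τ)/2) (by fun_prop) (by simp only [ht]; linarith)
    · exact mul_ne_zero (Real.Gamma_pos_of_pos (by simp only [ht]; linarith)).ne'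
        (Real.Gamma_pos_of_pos (by simp only [ht]; linarith)).ne'
  have hmax : IsLocalMax (csFun N s) t := by
    filter_upwards [Ioo_mem_nhds (show -(N:ℝ) < t by rw [ht]; linarith)
      (show t < 2*s by rw [ht]; linarith)] with τ hτ
    by_cases h : τ = t
    · rw [h]
    · exact (csFun_lt hN hs hs1 hτ.1 hτ.2 h).le
  have := hd.hasDerivAt
  rwa [hmax.deriv_eq_zero] at this

lemma Dop_measurable {N : ℕ} {f : EN N → ℝ} (hf : Measurable f) :
    Measurable (fun q : ℝ × EN N => Dop N f q.1 q.2) := by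
  have hm : Measurable (fun q : (ℝ × EN N) × EN N => (f q.1.2 - f q.2) * hk N q.1.1 (q.1.2 - q.2)) := by
    unfold hk; fun_prop
  exact (hm.stronglyMeasurable.integral_prod_right (ν := (volume : Measure (EN N)))).measurable

lemma theta_hk_eq {N : ℕ} {s : ℝ} {z : EN N} {θ : ℝ} (hθ : 0 < θ) :
    θ^(-1-s) * hk N θ z = θ^(-((N:ℝ)/2+s)-1) * Real.exp (-‖z‖^2/θ) := by
  unfold hk
  rw [← mul_assoc, ← Real.rpow_add hθ]
  congr 2; ring

lemma theta_hk_integrable {N : ℕ} (hN : 2 ≤ N) {s : ℝ} (hs : 0 < s) {z : EN N} (hz : z ≠ 0) :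
    IntegrableOn (fun θ => θ^(-1-s) * hk N θ z) (Ioi 0) :=
  (invgamma_integrable (α := (N:ℝ)/2+s) (c := ‖z‖^2) (by positivity)
    (by have := norm_pos_iff.2 hz; positivity)).congr_fun
    (fun _ hσ => (theta_hk_eq hσ).symm) measurableSet_Ioi

lemma theta_hk_integral {N : ℕ} (hN : 2 ≤ N) {s : ℝ} (hs : 0 < s) {z : EN N} (hz : z ≠ 0) :
    ∫ θ in Ioi (0:ℝ), θ^(-1-s) * hk N θ z = Real.Gamma ((N:ℝ)/2+s) / ‖z‖^((N:ℝ)+2*s) := by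
  have hz' := norm_pos_iff.2 hz
  rw [setIntegral_congr_fun measurableSet_Ioi (fun σ hσ => theta_hk_eq hσ),
    invgamma_integral (by positivity) (by positivity), div_eq_mul_inv (Real.Gamma _), ← Real.rpow_neg hz'.le]
  congr 1
  rw [← Real.rpow_natCast, ← Real.rpow_mul hz'.le]
  congr 1; push_cast; ring

section fub
variable {Y : Type*} [MeasurableSpace Y] {ν : Measure Y} [SFinite ν]

lemma theta_fubini {N : ℕ} (hN : 2 ≤ N) {s : ℝ} (hs : 0 < s) {z : Y → EN N} (hzm : Measurable z)
    (hz : ∀ᵐ y ∂ν, z y ≠ 0) {F : Y → ℝ}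
    (hF : Integrable (fun y => F y / ‖z y‖^((N:ℝ)+2*s)) ν) :
    Integrable (fun q : ℝ × Y => q.1^(-1-s) * (F q.2 * hk N q.1 (z q.2)))
      ((volume.restrict (Ioi 0)).prod ν) := by
  have hFm : AEStronglyMeasurable F ν := by
    have : AEStronglyMeasurable (fun y => (F y / ‖z y‖^((N:ℝ)+2*s)) * ‖z y‖^((N:ℝ)+2*s)) ν :=
      hF.aestronglyMeasurable.mul
        (Measurable.aestronglyMeasurable (by fun_prop))
    refine this.congr ?_
    filter_upwards [hz] with y hy
    have := norm_pos_iff.2 hy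
    exact div_mul_cancel₀ _ (by positivity)
  have hm : AEStronglyMeasurable (fun q : ℝ × Y => q.1^(-1-s) * (F q.2 * hk N q.1 (z q.2)))
      ((volume.restrict (Ioi 0)).prod ν) := by
    refine AEStronglyMeasurable.mul (Measurable.aestronglyMeasurable (by fun_prop)) (AEStronglyMeasurable.mul ?_ ?_)
    · exact hFm.comp_quasiMeasurePreserving Measure.quasiMeasurePreserving_snd
    · refine Measurable.aestronglyMeasurable ?_
      unfold hk; fun_prop
  rw [integrable_prod_iff' hm]
  constructor
  · filter_upwards [hz] with y hy
    refine ((theta_hk_integrable hN hs hy).const_mul (F y)).congr (ae_of_all _ fun θ => ?_)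
    simp only; ring
  · refine (hF.norm.const_mul (Real.Gamma ((N:ℝ)/2+s))).congr ?_
    filter_upwards [hz] with y hy
    have : ∀ θ ∈ Ioi (0:ℝ), ‖θ^(-1-s) * (F y * hk N θ (z y))‖ = |F y| * (θ^(-1-s) * hk N θ (z y)) := by
      intro θ hθ
      have hθ : 0 < θ := hθ
      rw [Real.norm_eq_abs, abs_mul, abs_mul, abs_of_nonneg (hk_nonneg N hθ.le _),
        abs_of_nonneg (by positivity)]; ring
    rw [setIntegral_congr_fun measurableSet_Ioi this, integral_const_mul,
      theta_hk_integral hN hs hy, Real.norm_eq_abs, abs_div, abs_of_nonneg (a := ‖z y‖^_) (by positivity)]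
    ring

lemma theta_fubini_sec {N : ℕ} (hN : 2 ≤ N) {s : ℝ} (hs : 0 < s) {z : Y → EN N}
    (hz : ∀ᵐ y ∂ν, z y ≠ 0) (F : Y → ℝ) :
    ∫ y, (∫ θ in Ioi (0:ℝ), θ^(-1-s) * (F y * hk N θ (z y))) ∂ν =
      Real.Gamma ((N:ℝ)/2+s) * ∫ y, F y / ‖z y‖^((N:ℝ)+2*s) ∂ν := by
  rw [← integral_const_mul]
  refine integral_congr_ae ?_
  filter_upwards [hz] with y hy
  have : ∀ θ : ℝ, θ^(-1-s) * (F y * hk N θ (z y)) = F y * (θ^(-1-s) * hk N θ (z y)) := fun θ => by ring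
  simp_rw [this]
  rw [integral_const_mul, theta_hk_integral hN hs hy]; ring

lemma theta_fubini_integral {N : ℕ} (hN : 2 ≤ N) {s : ℝ} (hs : 0 < s) {z : Y → EN N} (hzm : Measurable z)
    (hz : ∀ᵐ y ∂ν, z y ≠ 0) {F : Y → ℝ}
    (hF : Integrable (fun y => F y / ‖z y‖^((N:ℝ)+2*s)) ν) :
    IntegrableOn (fun θ : ℝ => θ^(-1-s) * ∫ y, F y * hk N θ (z y) ∂ν) (Ioi 0) ∧
    ∫ θ in Ioi (0:ℝ), θ^(-1-s) * ∫ y, F y * hk N θ (z y) ∂ν =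
      Real.Gamma ((N:ℝ)/2+s) * ∫ y, F y / ‖z y‖^((N:ℝ)+2*s) ∂ν := by
  have h := theta_fubini hN hs hzm hz hF
  have e : ∀ θ : ℝ, θ^(-1-s) * ∫ y, F y * hk N θ (z y) ∂ν = ∫ y, θ^(-1-s) * (F y * hk N θ (z y)) ∂ν :=
    fun θ => (integral_const_mul _ _).symm
  simp_rw [e]
  refine ⟨h.integral_prod_left, ?_⟩
  rw [integral_integral_swap (f := fun θ y => θ^(-1-s) * (F y * hk N θ (z y))) h,
    theta_fubini_sec hN hs hz]

lemma theta_fubini_ae {N : ℕ} (hN : 2 ≤ N) {s : ℝ} (hs : 0 < s) {z : Y → EN N} (hzm : Measurable z)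
    (hz : ∀ᵐ y ∂ν, z y ≠ 0) {F : Y → ℝ}
    (hF : Integrable (fun y => F y / ‖z y‖^((N:ℝ)+2*s)) ν) :
    ∀ᵐ θ ∂(volume.restrict (Ioi (0:ℝ))), Integrable (fun y => F y * hk N θ (z y)) ν := by
  have h := theta_fubini hN hs hzm hz hF
  filter_upwards [h.prod_right_ae, ae_restrict_mem measurableSet_Ioi] with θ hθ hpos
  have hpos : 0 < θ := hpos
  have := hθ.const_mul (θ^(-1-s))⁻¹
  refine this.congr (ae_of_all _ fun y => ?_)
  simp only
  rw [← mul_assoc, inv_mul_cancel₀ (by positivity), one_mul]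

lemma theta_fubini_abs {N : ℕ} (hN : 2 ≤ N) {s : ℝ} (hs : 0 < s) {z : Y → EN N} (hzm : Measurable z)
    (hz : ∀ᵐ y ∂ν, z y ≠ 0) {F : Y → ℝ}
    (hF : Integrable (fun y => F y / ‖z y‖^((N:ℝ)+2*s)) ν) :
    ∫ θ in Ioi (0:ℝ), |θ^(-1-s) * ∫ y, F y * hk N θ (z y) ∂ν| ≤
      Real.Gamma ((N:ℝ)/2+s) * ∫ y, |F y| / ‖z y‖^((N:ℝ)+2*s) ∂ν := by
  have hF' : Integrable (fun y => |F y| / ‖z y‖^((N:ℝ)+2*s)) ν := by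
    refine hF.abs.congr (ae_of_all _ fun y => ?_)
    simp only
    rw [abs_div, abs_of_nonneg (a := ‖z y‖^_) (by positivity)]
  obtain ⟨h1, -⟩ := theta_fubini_integral hN hs hzm hz hF
  obtain ⟨h2, h3⟩ := theta_fubini_integral hN hs hzm hz hF'
  rw [← h3]
  refine setIntegral_mono_on h1.abs h2 measurableSet_Ioi fun θ hθ => ?_
  have hθ : 0 < θ := hθ
  rw [abs_mul, abs_of_nonneg (by positivity)]
  gcongr
  refine abs_integral_le_integral_abs.trans (le_of_eq ?_)
  congr 1; ext y
  rw [abs_mul, abs_of_nonneg (hk_nonneg N hθ.le _)]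

end fub

lemma lip_radial {N : ℕ} {φ φ' : ℝ → ℝ} (hd : ∀ t, 0 < t → HasDerivAt φ (φ' t) t)
    (hc : ContinuousOn φ' (Ioi 0)) {δ R : ℝ} (hδ : 0 < δ) :
    ∃ K : ℝ, 0 ≤ K ∧ ∀ x y : EN N, δ ≤ ‖x‖ → ‖x‖ ≤ R → δ ≤ ‖y‖ → ‖y‖ ≤ R →
      |φ ‖x‖ - φ ‖y‖| ≤ K * dist x y := by
  obtain ⟨C, hC⟩ := (isCompact_Icc (a := δ) (b := R)).exists_bound_of_continuousOn
    (hc.mono fun t ht => lt_of_lt_of_le hδ ht.1)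
  refine ⟨|C|, abs_nonneg _, fun x y hx hx' hy hy' => ?_⟩
  have := (convex_Icc δ R).norm_image_sub_le_of_norm_hasDerivWithin_le (f := φ) (f' := φ') (C := |C|)
    (fun t ht => (hd t (lt_of_lt_of_le hδ ht.1)).hasDerivWithinAt)
    (fun t ht => (hC t ht).trans (le_abs_self C)) (x := ‖y‖) (y := ‖x‖) ⟨hy, hy'⟩ ⟨hx, hx'⟩
  rw [← Real.norm_eq_abs]
  refine this.trans ?_
  gcongr
  rw [dist_eq_norm, Real.norm_eq_abs]
  exact abs_norm_sub_norm_le x y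

lemma bdd_radial {φ : ℝ → ℝ} (hc : ContinuousOn φ (Ioi 0)) {δ R : ℝ} (hδ : 0 < δ) :
    ∃ C : ℝ, ∀ t, δ ≤ t → t ≤ R → φ t ≤ C := by
  obtain ⟨C, hC⟩ := (isCompact_Icc (a := δ) (b := R)).exists_bound_of_continuousOn
    (hc.mono fun t ht => lt_of_lt_of_le hδ ht.1)
  exact ⟨C, fun t h1 h2 => (le_abs_self _).trans (hC t ⟨h1, h2⟩)⟩

/-- A nonnegative pointwise supersolution dominating `Φ` near the origin. -/
structure SuperSol (N : ℕ) (s μ τm : ℝ) (Ω : Set (EN N)) (Ψ : EN N → ℝ) : Prop where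
  meas : Measurable Ψ
  nonneg : ∀ x, 0 ≤ Ψ x
  lower : ∀ δ : ℝ, 0 < δ → ∃ c : ℝ, 0 < c ∧ ∀ x ∈ Ω, δ ≤ ‖x‖ → c ≤ Ψ x
  upper : ∀ δ : ℝ, 0 < δ → ∃ C : ℝ, ∀ x ∈ Ω, δ ≤ ‖x‖ → Ψ x ≤ C
  lip : ∃ R : ℝ, closure Ω ⊆ ball 0 R ∧ ∀ δ : ℝ, 0 < δ → ∃ K : ℝ, 0 ≤ K ∧
    ∀ x y : EN N, δ ≤ ‖x‖ → ‖x‖ < R → δ ≤ ‖y‖ → ‖y‖ < R → |Ψ x - Ψ y| ≤ K * dist x y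
  hkint : ∀ x ∈ Ω, x ≠ 0 → ∀ θ : ℝ, 0 < θ → Integrable (fun y => Ψ y * hk N θ (x - y))
  dint : ∀ x ∈ Ω, x ≠ 0 → IntegrableOn (fun θ => θ^(-1-s) * Dop N Ψ θ x) (Ioi 0)
  dabs : ∀ δ : ℝ, 0 < δ → ∃ C : ℝ, ∀ x ∈ Ω, δ ≤ ‖x‖ →
    ∫ θ in Ioi (0:ℝ), |θ^(-1-s) * Dop N Ψ θ x| ≤ C
  super : ∀ x ∈ Ω, x ≠ 0 → 0 ≤ CNs N s / Real.Gamma ((N:ℝ)/2+s) *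
    (∫ θ in Ioi (0:ℝ), θ^(-1-s) * Dop N Ψ θ x) + μ * (Ψ x / ‖x‖^(2*s))
  near : ∃ K : ℝ, 0 < K ∧ ∀ᶠ x in 𝓝[≠] (0:EN N), 0 < Phi N s μ τm x ∧ Phi N s μ τm x ≤ K * Ψ x

lemma exists_R {N : ℕ} {Ω : Set (EN N)} (hb : Bornology.IsBounded Ω) :
    ∃ R : ℝ, 1 ≤ R ∧ closure Ω ⊆ ball 0 R := by
  obtain ⟨R, hR⟩ := hb.closure.subset_ball 0
  exact ⟨max R 1, le_max_right _ _, hR.trans (ball_subset_ball (le_max_left _ _))⟩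

lemma ne_zero_of_le {N : ℕ} {δ : ℝ} (hδ : 0 < δ) {x : EN N} (h : δ ≤ ‖x‖) : x ≠ 0 := by
  rw [← norm_pos_iff]; linarith

lemma superSol_pow {N : ℕ} (hN : 2 ≤ N) {s μ τ : ℝ} (hs : 0 < s) (hs1 : s < 1) (h1 : -(N:ℝ) < τ)
    (h2 : τ < 0) (hc : csFun N s τ = -μ) (hμ : μ ≠ mu0 N s) {Ω : Set (EN N)}
    (hb : Bornology.IsBounded Ω) : SuperSol N s μ τ Ω (fun x => ‖x‖^τ) := by
  obtain ⟨R, hR1, hR⟩ := exists_R hb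
  have hR' : ∀ x ∈ Ω, ‖x‖ < R := fun x hx => by simpa using hR (subset_closure hx)
  have hcont : ∀ a : ℝ, ContinuousOn (fun t : ℝ => t^a) (Ioi 0) := fun a t ht =>
    (Real.continuousAt_rpow_const t a (Or.inl (ne_of_gt ht))).continuousWithinAt
  constructor
  · fun_prop
  · intro x; positivity
  · intro δ hδ
    refine ⟨R^τ, by positivity, fun x hx hx' => ?_⟩
    exact Real.rpow_le_rpow_of_nonpos (by linarith) (hR' x hx).le h2.le
  · intro δ hδ
    exact ⟨δ^τ, fun x hx hx' => Real.rpow_le_rpow_of_nonpos hδ hx' h2.le⟩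
  · refine ⟨R, hR, fun δ hδ => ?_⟩
    obtain ⟨K, hK, h⟩ := lip_radial (N := N) (φ := fun t => t^τ) (φ' := fun t => τ * t^(τ-1))
      (fun t ht => Real.hasDerivAt_rpow_const (Or.inl ht.ne')) ((hcont _).const_smul τ) (R := R) hδ
    exact ⟨K, hK, fun x y a b c d => h x y a b.le c d.le⟩
  · intro x _ _ θ hθ; exact pow_hk_integrable hN h1 h2 hθ x
  · intro x _ hx; exact powD_integrable hN hs hs1 h1 h2 hx
  · intro δ hδ
    obtain ⟨C, hC⟩ := powD_abs hN hs hs1 h1 h2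
    obtain ⟨C', hC'⟩ := bdd_radial (φ := fun t => C * t^(τ-2*s)) ((hcont _).const_smul C) (R := R) hδ
    exact ⟨C', fun x hx hx' => (hC x (ne_zero_of_le hδ hx')).trans (hC' _ hx' (hR' x hx).le)⟩
  · intro x _ hx
    rw [powD_integral hN hs hs1 h1 h2 hx, hc, Real.rpow_sub (norm_pos_iff.2 hx)]
    exact le_of_eq (by ring)
  · refine ⟨1, one_pos, ?_⟩
    filter_upwards [self_mem_nhdsWithin] with x hx
    have := norm_pos_iff.2 hx
    rw [Phi, if_neg hμ]
    exact ⟨by positivity, by simp⟩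

def lf (N : ℕ) (τ : ℝ) (y : EN N) : ℝ := -(‖y‖^τ * Real.log ‖y‖)

lemma lf_measurable {N : ℕ} {τ : ℝ} : Measurable (lf N τ) := by
  unfold lf; fun_prop

lemma abs_log_le {r h : ℝ} (hr : 0 < r) (hh : 0 < h) : |Real.log r| ≤ (r^h + r^(-h))/h := by
  have h1 := Real.log_le_rpow_div hr.le hh
  have h2 := Real.log_le_rpow_div (inv_pos.2 hr).le hh
  rw [Real.log_inv, Real.inv_rpow hr.le, ← Real.rpow_neg hr.le] at h2
  have h3 : 0 < r^h/h := by positivity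
  have h4 : 0 < r^(-h)/h := by positivity
  rw [add_div, abs_le]
  constructor <;> linarith

lemma exists_h {N : ℕ} {τ : ℝ} (h1 : -(N:ℝ) < τ) (h2 : τ < 0) :
    ∃ h : ℝ, 0 < h ∧ -(N:ℝ) < τ - h ∧ τ + h < 0 := by
  refine ⟨min ((N+τ)/2) (-τ/2), lt_min (by linarith) (by linarith), ?_, ?_⟩
  · have := min_le_left (((N:ℝ)+τ)/2) (-τ/2); linarith
  · have := min_le_right (((N:ℝ)+τ)/2) (-τ/2); linarith

lemma lf_hk_integrable {N : ℕ} (hN : 2 ≤ N) {τ θ : ℝ} (h1 : -(N:ℝ) < τ) (h2 : τ < 0) (hθ : 0 < θ)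
    (x : EN N) : Integrable (fun y : EN N => lf N τ y * hk N θ (x-y)) := by
  obtain ⟨h, hh, h3, h4⟩ := exists_h h1 h2
  have i1 := pow_hk_integrable hN (τ := τ+h) (by linarith) h4 hθ x
  have i2 := pow_hk_integrable hN (τ := τ-h) h3 (by linarith) hθ x
  refine Integrable.mono' ((i1.add i2).const_mul (1/h)) ?_ ?_
  · refine Measurable.aestronglyMeasurable ?_
    unfold lf hk; fun_prop
  · filter_upwards [ae_ne_zero_EN hN] with y hy
    have hy := norm_pos_iff.2 hy
    have hkn := hk_nonneg N hθ.le (x-y)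
    rw [Real.norm_eq_abs, abs_mul, abs_of_nonneg hkn, lf, abs_neg, abs_mul,
      abs_of_nonneg (by positivity)]
    have := abs_log_le hy hh
    simp only [Pi.add_apply]
    rw [sub_eq_add_neg τ h, Real.rpow_add hy, Real.rpow_add hy]
    calc _ ≤ ‖y‖^τ * ((‖y‖^h+‖y‖^(-h))/h) * hk N θ (x-y) := by gcongr
      _ = _ := by ring

lemma logD_ineq {N : ℕ} (hN : 2 ≤ N) {τ θ h : ℝ} (h1 : -(N:ℝ) < τ) (h2 : τ < 0)
    (h3 : -(N:ℝ) < τ + h) (h4 : τ + h < 0) (hθ : 0 < θ) {x : EN N} (hx : x ≠ 0) :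
    h * Dop N (lf N τ) θ x ≤ (1 - h * Real.log ‖x‖) * Dop N (fun y => ‖y‖^τ) θ x
      - ‖x‖^(-h) * Dop N (fun y => ‖y‖^(τ+h)) θ x := by
  have hx' := norm_pos_iff.2 hx
  have i1 := pow_hk_integrable hN h1 h2 hθ x
  have i2 := pow_hk_integrable hN h3 h4 hθ x
  have i3 := lf_hk_integrable hN h1 h2 hθ x
  rw [Dop_eq hθ i1, Dop_eq hθ i2, Dop_eq hθ i3]
  have key : (1 - h * Real.log ‖x‖) * (∫ y : EN N, ‖y‖^τ * hk N θ (x-y)) -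
      h * (∫ y : EN N, lf N τ y * hk N θ (x-y)) ≤ ‖x‖^(-h) * ∫ y : EN N, ‖y‖^(τ+h) * hk N θ (x-y) := by
    rw [← integral_const_mul, ← integral_const_mul, ← integral_const_mul,
      ← integral_sub (i1.const_mul _) (i3.const_mul _)]
    refine integral_mono_ae ((i1.const_mul _).sub (i3.const_mul _)) (i2.const_mul _) ?_
    filter_upwards [ae_ne_zero_EN hN] with y hy
    have hy := norm_pos_iff.2 hy
    have hkn := hk_nonneg N hθ.le (x-y)
    have e := Real.add_one_le_exp (h * (Real.log ‖y‖ - Real.log ‖x‖))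
    have e2 : ‖x‖^(-h) * ‖y‖^(τ+h) = ‖y‖^τ * Real.exp (h * (Real.log ‖y‖ - Real.log ‖x‖)) := by
      rw [Real.rpow_add hy, Real.rpow_def_of_pos hx', Real.rpow_def_of_pos hy h]
      rw [show h * (Real.log ‖y‖ - Real.log ‖x‖) = Real.log ‖x‖ * -h + Real.log ‖y‖ * h by ring, Real.exp_add]
      ring
    simp only [lf, ← mul_assoc]
    rw [e2]
    have : ‖y‖^τ * (h * (Real.log ‖y‖ - Real.log ‖x‖) + 1) ≤
      ‖y‖^τ * Real.exp (h * (Real.log ‖y‖ - Real.log ‖x‖)) := by gcongr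
    have := mul_le_mul_of_nonneg_right this hkn
    refine le_trans (le_of_eq ?_) this
    ring
  have e3 : ‖x‖^(-h) * ‖x‖^(τ+h) = ‖x‖^τ := by
    rw [← Real.rpow_add hx']; congr 1; ring
  have e4 : lf N τ x = - (‖x‖^τ * Real.log ‖x‖) := rfl
  rw [e4]
  generalize (∫ y : EN N, ‖y‖^τ * hk N θ (x-y)) = I1 at *
  generalize (∫ y : EN N, ‖y‖^(τ+h) * hk N θ (x-y)) = I2 at *
  generalize (∫ y : EN N, lf N τ y * hk N θ (x-y)) = I3 at *
  have e5 : ‖x‖^(-h) * (Real.pi^((N:ℝ)/2) * ‖x‖^(τ+h) - I2) = Real.pi^((N:ℝ)/2) * ‖x‖^τ - ‖x‖^(-h) * I2 := by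
    rw [← e3]; ring
  rw [e5]
  linarith

lemma logD_bound {N : ℕ} (hN : 2 ≤ N) {τ θ h : ℝ} (h1 : -(N:ℝ) < τ) (h2 : τ < 0) (hh : 0 < h)
    (h3 : -(N:ℝ) < τ - h) (h4 : τ + h < 0) (hθ : 0 < θ) {x : EN N} (hx : x ≠ 0) :
    |Dop N (lf N τ) θ x| ≤ (1/h) * (2 * ((1 + h * |Real.log ‖x‖|) * |Dop N (fun y => ‖y‖^τ) θ x|)
      + ‖x‖^(-h) * |Dop N (fun y => ‖y‖^(τ+h)) θ x| + ‖x‖^h * |Dop N (fun y => ‖y‖^(τ-h)) θ x|) := by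
  have hx' := norm_pos_iff.2 hx
  have a := logD_ineq hN h1 h2 (h := h) (by linarith) h4 hθ hx
  have b := logD_ineq hN h1 h2 (h := -h) (by linarith) (by linarith) hθ hx
  rw [neg_neg, ← sub_eq_add_neg] at b
  generalize Dop N (lf N τ) θ x = A at *
  generalize Dop N (fun y => ‖y‖^τ) θ x = B at *
  generalize Dop N (fun y => ‖y‖^(τ+h)) θ x = C at *
  generalize Dop N (fun y => ‖y‖^(τ-h)) θ x = D at *
  generalize Real.log ‖x‖ = l at *
  have p1 : 0 < ‖x‖^h := by positivity
  have p2 : 0 < ‖x‖^(-h) := by positivity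
  generalize ‖x‖^h = E at *
  generalize ‖x‖^(-h) = F at *
  rw [one_div, ← div_eq_inv_mul, le_div_iff₀ hh, mul_comm, ← abs_of_pos hh, ← abs_mul, abs_of_pos hh]
  have q1 : (1 - h*l) * B ≤ (1 + h*|l|) * |B| := by
    refine (le_abs_self _).trans ?_
    rw [abs_mul]; gcongr
    refine (abs_sub _ _).trans ?_
    rw [abs_one, abs_mul, abs_of_pos hh]
  have q2 : (1 - -h*l) * B ≤ (1 + h*|l|) * |B| := by
    refine (le_abs_self _).trans ?_
    rw [abs_mul]; gcongr
    refine (abs_sub _ _).trans ?_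
    rw [abs_one, abs_mul, abs_neg, abs_of_pos hh]
  have q3 : -(F * C) ≤ F * |C| := by rw [← mul_neg]; gcongr; exact neg_le_abs C
  have q4 : -(E * D) ≤ E * |D| := by rw [← mul_neg]; gcongr; exact neg_le_abs D
  have q5 : 0 ≤ (1 + h*|l|) * |B| := by positivity
  have q6 : 0 ≤ F * |C| := by positivity
  have q7 : 0 ≤ E * |D| := by positivity
  rw [abs_le]
  constructor <;> linarith

lemma logD_integrable {N : ℕ} (hN : 2 ≤ N) {s τ : ℝ} (hs : 0 < s) (hs1 : s < 1)
    (h1 : -(N:ℝ) < τ) (h2 : τ < 0) {h : ℝ} (hh : 0 < h)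
    (h3 : -(N:ℝ) < τ - h) (h4 : τ + h < 0) {x : EN N} (hx : x ≠ 0) :
    IntegrableOn (fun θ => θ^(-1-s) * Dop N (lf N τ) θ x) (Ioi 0) ∧
    ∫ θ in Ioi (0:ℝ), |θ^(-1-s) * Dop N (lf N τ) θ x| ≤
      (1/h) * (2 * ((1 + h * |Real.log ‖x‖|) * ∫ θ in Ioi (0:ℝ), |θ^(-1-s) * Dop N (fun y => ‖y‖^τ) θ x|)
      + ‖x‖^(-h) * (∫ θ in Ioi (0:ℝ), |θ^(-1-s) * Dop N (fun y => ‖y‖^(τ+h)) θ x|)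
      + ‖x‖^h * ∫ θ in Ioi (0:ℝ), |θ^(-1-s) * Dop N (fun y => ‖y‖^(τ-h)) θ x|) := by
  have i1 := (powD_integrable hN hs hs1 h1 h2 hx).abs
  have i2 := (powD_integrable hN hs hs1 (τ := τ+h) (by linarith) h4 hx).abs
  have i3 := (powD_integrable hN hs hs1 (τ := τ-h) h3 (by linarith) hx).abs
  have j1 := ((i1.const_mul (1 + h * |Real.log ‖x‖|)).const_mul 2)
  have j2 := i2.const_mul (‖x‖^(-h))
  have j3 := i3.const_mul (‖x‖^h)
  have j := ((j1.add j2).add j3).const_mul (1/h)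
  have hle : ∀ θ ∈ Ioi (0:ℝ), |θ^(-1-s) * Dop N (lf N τ) θ x| ≤ 
      (1/h) * (2 * ((1 + h * |Real.log ‖x‖|) * |θ^(-1-s) * Dop N (fun y => ‖y‖^τ) θ x|)
      + ‖x‖^(-h) * |θ^(-1-s) * Dop N (fun y => ‖y‖^(τ+h)) θ x|
      + ‖x‖^h * |θ^(-1-s) * Dop N (fun y => ‖y‖^(τ-h)) θ x|) := by
    intro θ hθ
    have hθ : 0 < θ := hθ
    have hp : 0 < θ^(-1-s) := by positivity
    simp only [abs_mul, abs_of_pos hp]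
    have := mul_le_mul_of_nonneg_left (logD_bound hN h1 h2 hh h3 h4 hθ hx) hp.le
    refine this.trans (le_of_eq ?_)
    ring
  have hi : IntegrableOn (fun θ => θ^(-1-s) * Dop N (lf N τ) θ x) (Ioi 0) := by
    refine Integrable.mono' j ?_ ?_
    · have := (Dop_measurable (lf_measurable (N := N) (τ := τ))).comp (measurable_prodMk_right (y := x))
      exact ((measurable_id.pow_const (-1-s)).mul this).aestronglyMeasurable
    · filter_upwards [ae_restrict_mem measurableSet_Ioi] with θ hθ
      exact hle θ hθ
  refine ⟨hi, ?_⟩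
  refine (setIntegral_mono_on hi.abs j measurableSet_Ioi hle).trans (le_of_eq ?_)
  rw [integral_const_mul]
  congr 1
  refine (integral_add (j1.add j2) j3).trans ?_
  refine (congrArg (· + _) (integral_add j1 j2)).trans ?_
  simp only [integral_const_mul]

lemma logD_super {N : ℕ} (hN : 2 ≤ N) {s τ : ℝ} (hs : 0 < s) (hs1 : s < 1)
    (h1 : -(N:ℝ) < τ) (h2 : τ < 0) (hd : HasDerivAt (csFun N s) 0 τ) {x : EN N} (hx : x ≠ 0) :
    csFun N s τ * (-(‖x‖^(τ-2*s) * Real.log ‖x‖)) ≤ CNs N s / Real.Gamma ((N:ℝ)/2+s) *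
      ∫ θ in Ioi (0:ℝ), θ^(-1-s) * Dop N (lf N τ) θ x := by
  have hx' := norm_pos_iff.2 hx
  obtain ⟨h0, hh0, h3, h4⟩ := exists_h h1 h2
  obtain ⟨hi, -⟩ := logD_integrable hN hs hs1 h1 h2 hh0 h3 h4 hx
  have hκ : 0 ≤ CNs N s / Real.Gamma ((N:ℝ)/2+s) := by
    have := Real.Gamma_pos_of_pos (show 0 < (N:ℝ)/2+s by positivity)
    have := Real.Gamma_pos_of_pos (show 0 < 1 - s by linarith)
    have := Real.Gamma_pos_of_pos (show 0 < ((N:ℝ)+2*s)/2 by positivity)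
    unfold CNs; positivity
  set κ := CNs N s / Real.Gamma ((N:ℝ)/2+s) with hκd
  set I := ∫ θ in Ioi (0:ℝ), θ^(-1-s) * Dop N (lf N τ) θ x with hI
  have key : ∀ h : ℝ, -h0 < h → h < 0 →
      ‖x‖^(τ-2*s) * (-(csFun N s τ * Real.log ‖x‖) - h⁻¹ * (csFun N s (τ+h) - csFun N s τ)) ≤ κ * I := by
    intro h ha hb
    have i1 := (powD_integrable hN hs hs1 h1 h2 hx)
    have i2 := (powD_integrable hN hs hs1 (τ := τ+h) (by linarith) (by linarith) hx)
    have := setIntegral_mono_on (hi.const_mul h) ((i1.const_mul (1 - h * Real.log ‖x‖)).sub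
      (i2.const_mul (‖x‖^(-h)))) measurableSet_Ioi (fun θ hθ => by
        have hθ : 0 < θ := hθ
        have hp : 0 < θ^(-1-s) := by positivity
        have := mul_le_mul_of_nonneg_left (logD_ineq hN h1 h2 (h := h) (by linarith) (by linarith) hθ hx) hp.le
        refine le_trans (le_of_eq ?_) (this.trans (le_of_eq ?_))
        · ring
        · simp only [Pi.sub_apply]; ring)
    have e := integral_sub (i1.const_mul (1 - h * Real.log ‖x‖)) (i2.const_mul (‖x‖^(-h)))
    have this := this.trans_eq e
    rw [integral_const_mul, integral_const_mul, integral_const_mul, ← hI] at this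
    have this := mul_le_mul_of_nonneg_left this hκ
    have e1 := powD_integral hN hs hs1 h1 h2 hx
    have e2 := powD_integral hN hs hs1 (τ := τ+h) (by linarith) (by linarith) hx
    rw [← hκd] at e1 e2
    have e3 : ‖x‖^(-h) * ‖x‖^(τ+h-2*s) = ‖x‖^(τ-2*s) := by
      rw [← Real.rpow_add hx']; congr 1; ring
    have e4 : h * (κ * I) ≤ ‖x‖^(τ-2*s) * ((1 - h * Real.log ‖x‖) * csFun N s τ - csFun N s (τ+h)) := by
      refine le_trans (le_of_eq ?_) (this.trans (le_of_eq ?_))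
      · ring
      · rw [mul_sub, mul_left_comm, e1, mul_left_comm κ, e2]
        linear_combination (-(csFun N s (τ+h))) * e3
    have e5 : h * (‖x‖^(τ-2*s) * (-(csFun N s τ * Real.log ‖x‖) - h⁻¹ * (csFun N s (τ+h) - csFun N s τ)))
        = ‖x‖^(τ-2*s) * ((1 - h * Real.log ‖x‖) * csFun N s τ - csFun N s (τ+h)) := by
      have : h * h⁻¹ = 1 := mul_inv_cancel₀ hb.ne
      linear_combination (-(‖x‖^(τ-2*s) * (csFun N s (τ+h) - csFun N s τ))) * this
    rw [← e5] at e4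
    exact (mul_le_mul_left_of_neg hb).1 e4
  have ht := hd.tendsto_slope_zero_left
  simp only [smul_eq_mul] at ht
  have ht2 : Tendsto (fun h => ‖x‖^(τ-2*s) * (-(csFun N s τ * Real.log ‖x‖) -
      h⁻¹ * (csFun N s (τ+h) - csFun N s τ))) (𝓝[<] 0)
      (𝓝 (‖x‖^(τ-2*s) * (-(csFun N s τ * Real.log ‖x‖) - 0))) := (ht.const_sub _).const_mul _
  have := le_of_tendsto ht2 (b := κ * I) (by
    filter_upwards [Ioo_mem_nhdsLT (show -h0 < 0 by linarith)] with h hh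
    exact key h hh.1 hh.2)
  refine le_trans (le_of_eq ?_) this
  ring

def tailA (N : ℕ) (R : ℝ) : Set (EN N) := {y | R ≤ ‖y‖}

lemma tailA_meas {N : ℕ} {R : ℝ} : MeasurableSet (tailA N R) :=
  measurableSet_le measurable_const measurable_norm

lemma tail_pow {N : ℕ} {R a : ℝ} (hR : 1 ≤ R) (ha : (N:ℝ) < a) :
    IntegrableOn (fun y : EN N => ‖y‖^(-a)) (tailA N R) := by
  have ha0 : 0 < a := lt_of_le_of_lt (Nat.cast_nonneg N) ha
  have h := (integrable_one_add_norm (E := EN N) (μ := volume) (r := a) (by simpa using ha)).const_mul (2^a)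
  refine Integrable.mono' h.integrableOn (Measurable.aestronglyMeasurable (by fun_prop)) ?_
  filter_upwards [ae_restrict_mem tailA_meas] with y hy
  have hy1 : 1 ≤ ‖y‖ := hR.trans hy
  rw [Real.norm_of_nonneg (by positivity)]
  have e : (2:ℝ)^a * (2*‖y‖)^(-a) = ‖y‖^(-a) := by
    rw [Real.mul_rpow (by norm_num) (by positivity), ← mul_assoc, ← Real.rpow_add (by norm_num)]
    simp
  rw [← e]
  gcongr 2^a * ?_
  exact Real.rpow_le_rpow_of_nonpos (by positivity) (by linarith) (by linarith)

lemma tail_log {N : ℕ} {R s τ : ℝ} (hR : 1 ≤ R) (hs : 0 < s) (hτ : τ < 0) :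
    IntegrableOn (fun y : EN N => ‖y‖^(τ-(N+2*s)) * Real.log ‖y‖) (tailA N R) := by
  have h := (tail_pow (N := N) (R := R) (a := N+2*s-τ-s) hR (by linarith)).const_mul (1/s)
  refine Integrable.mono' h (Measurable.aestronglyMeasurable (by fun_prop)) ?_
  filter_upwards [ae_restrict_mem tailA_meas] with y hy
  have hy1 : 1 ≤ ‖y‖ := hR.trans hy
  have hy0 : 0 < ‖y‖ := by linarith
  have hl := Real.log_nonneg hy1
  rw [Real.norm_of_nonneg (by positivity)]
  have := Real.log_le_rpow_div hy0.le hs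
  calc _ ≤ ‖y‖^(τ-(N+2*s)) * (‖y‖^s/s) := by gcongr
    _ = 1/s * (‖y‖^(τ-(N+2*s)) * ‖y‖^s) := by ring
    _ = _ := by rw [← Real.rpow_add hy0]; congr 2; ring

lemma tail_ker {N : ℕ} {a R : ℝ} (ha : 0 < a) (hR : 1 ≤ R) {x y : EN N} (hx : ‖x‖ ≤ R/2) (hy : R ≤ ‖y‖) :
    (3/2)^(-a) * ‖y‖^(-a) ≤ 1/‖x-y‖^a ∧ 1/‖x-y‖^a ≤ (1/2)^(-a) * ‖y‖^(-a) ∧ 0 < ‖x-y‖ := by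
  have h1 : ‖x-y‖ ≤ 3/2*‖y‖ := (norm_sub_le x y).trans (by linarith)
  have h2 : 1/2*‖y‖ ≤ ‖x-y‖ := by
    have := norm_sub_norm_le y x
    rw [norm_sub_rev] at this; linarith
  have hy0 : 0 < ‖y‖ := by linarith
  have h3 : 0 < ‖x-y‖ := by linarith
  rw [← Real.mul_rpow (by norm_num) hy0.le, ← Real.mul_rpow (by norm_num) hy0.le, one_div,
    ← Real.rpow_neg h3.le]
  exact ⟨Real.rpow_le_rpow_of_nonpos h3 h1 (by linarith),
    Real.rpow_le_rpow_of_nonpos (by positivity) h2 (by linarith), h3⟩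

set_option maxHeartbeats 400000 in
lemma tail_main {N : ℕ} (hN : 2 ≤ N) {R s τ : ℝ} (hR : 1 ≤ R) (hs : 0 < s) (hτ : τ < 0) :
    ∃ L C : ℝ, Real.log R + 1 ≤ L ∧ ∀ x : EN N, ‖x‖ ≤ R/2 →
      IntegrableOn (fun y : EN N => (‖y‖^τ * (L - Real.log ‖y‖)) / ‖x-y‖^((N:ℝ)+2*s)) (tailA N R) ∧
      0 ≤ ∫ y in tailA N R, (‖y‖^τ * (L - Real.log ‖y‖)) / ‖x-y‖^((N:ℝ)+2*s) ∧
      ∫ y in tailA N R, |‖y‖^τ * (L - Real.log ‖y‖)| / ‖x-y‖^((N:ℝ)+2*s) ≤ C := by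
  set a : ℝ := (N:ℝ)+2*s with ha
  have ha0 : 0 < a := by positivity
  have i1 : IntegrableOn (fun y : EN N => ‖y‖^(τ-a)) (tailA N R) := by
    have := tail_pow (N := N) (R := R) (a := a - τ) hR (by rw [ha]; linarith)
    simpa using this
  have i2 : IntegrableOn (fun y : EN N => ‖y‖^(τ-a) * Real.log ‖y‖) (tailA N R) := tail_log hR hs hτ
  have hI1 : 0 < ∫ y in tailA N R, ‖y‖^(τ-a) := by
    rw [setIntegral_pos_iff_support_of_nonneg_ae (ae_of_all _ fun y => by
      simp only [Pi.zero_apply]; positivity) i1]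
    have : Nontrivial (EN N) := by
      have : Nonempty (Fin N) := ⟨⟨0, by omega⟩⟩
      infer_instance
    have hsub : {y : EN N | R < ‖y‖} ⊆ (Function.support fun y : EN N => ‖y‖^(τ-a)) ∩ tailA N R := by
      intro y hy
      have hy : R < ‖y‖ := hy
      have : 0 < ‖y‖ := by linarith
      exact ⟨by simp only [Function.mem_support]; positivity, hy.le⟩
    refine lt_of_lt_of_le ?_ (measure_mono hsub)
    refine IsOpen.measure_pos volume (isOpen_lt continuous_const continuous_norm) ?_
    exact NormedSpace.exists_lt_norm ℝ (EN N) R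
  obtain ⟨I1, hI1d⟩ : ∃ I, I = ∫ y in tailA N R, ‖y‖^(τ-a) := ⟨_, rfl⟩
  obtain ⟨I2, hI2d⟩ : ∃ I, I = ∫ y in tailA N R, ‖y‖^(τ-a) * Real.log ‖y‖ := ⟨_, rfl⟩
  rw [← hI1d] at hI1
  obtain ⟨c1, hc1d⟩ : ∃ c : ℝ, c = (3/2)^(-a) := ⟨_, rfl⟩
  obtain ⟨c2, hc2d⟩ : ∃ c : ℝ, c = (1/2)^(-a) := ⟨_, rfl⟩
  have hc1 : 0 < c1 := by rw [hc1d]; positivity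
  have hc2 : 0 < c2 := by rw [hc2d]; positivity
  have hker : ∀ x y : EN N, ‖x‖ ≤ R/2 → R ≤ ‖y‖ →
      c1 * ‖y‖^(-a) ≤ 1/‖x-y‖^a ∧ 1/‖x-y‖^a ≤ c2 * ‖y‖^(-a) ∧ 0 < ‖x-y‖ := by
    intro x y hx hy
    rw [hc1d, hc2d]
    exact tail_ker ha0 hR hx hy
  obtain ⟨L, hL1, hL2'⟩ : ∃ L, Real.log R + 1 ≤ L ∧ c2 * I2 / (c1 * I1) ≤ L :=
    ⟨max (Real.log R + 1) (c2 * I2 / (c1 * I1)), le_max_left _ _, le_max_right _ _⟩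
  have hL2 : c2 * I2 ≤ L * (c1 * I1) := by
    rwa [← div_le_iff₀ (by positivity)]
  have hL0 : 0 ≤ L := by have := Real.log_nonneg hR; linarith
  have hab : ∀ x : EN N, ‖x‖ ≤ R/2 → ∀ y ∈ tailA N R,
      |‖y‖^τ * (L - Real.log ‖y‖)| / ‖x-y‖^a ≤ c2 * (L * ‖y‖^(τ-a) + ‖y‖^(τ-a) * Real.log ‖y‖) := by
    intro x hx y hy
    have hy' : R ≤ ‖y‖ := hy
    obtain ⟨-, k2, k3⟩ := hker x y hx hy
    have hy0 : 0 < ‖y‖ := by linarith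
    have hl := Real.log_nonneg (show 1 ≤ ‖y‖ by linarith)
    rw [abs_mul, abs_of_nonneg (by positivity), div_eq_mul_one_div]
    have : |L - Real.log ‖y‖| ≤ L + Real.log ‖y‖ := by
      rw [abs_le]; constructor <;> linarith
    calc _ ≤ ‖y‖^τ * (L + Real.log ‖y‖) * (c2 * ‖y‖^(-a)) :=
          mul_le_mul (mul_le_mul_of_nonneg_left this (by positivity)) k2 (by positivity) (by positivity)
      _ = _ := by rw [sub_eq_add_neg τ a, Real.rpow_add hy0]; ring
  have idom : IntegrableOn (fun y : EN N => c2 * (L * ‖y‖^(τ-a) + ‖y‖^(τ-a) * Real.log ‖y‖)) (tailA N R) :=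
    ((i1.const_mul L).add i2).const_mul c2
  have hintg : ∀ x : EN N, ‖x‖ ≤ R/2 → IntegrableOn (fun y : EN N => (‖y‖^τ * (L - Real.log ‖y‖)) / ‖x-y‖^a) (tailA N R) := by
    intro x hx
    refine Integrable.mono' idom (Measurable.aestronglyMeasurable (by fun_prop)) ?_
    filter_upwards [ae_restrict_mem tailA_meas] with y hy
    refine le_trans (le_of_eq ?_) (hab x hx y hy)
    rw [Real.norm_eq_abs, abs_div, abs_of_nonneg (a := ‖x-y‖^a) (by positivity)]
  refine ⟨L, ∫ y in tailA N R, c2 * (L * ‖y‖^(τ-a) + ‖y‖^(τ-a) * Real.log ‖y‖), hL1, fun x hx =>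
    ⟨hintg x hx, ?_, ?_⟩⟩
  · have j : IntegrableOn (fun y : EN N => (L*c1) * ‖y‖^(τ-a) - c2 * (‖y‖^(τ-a) * Real.log ‖y‖)) (tailA N R) :=
      (i1.const_mul (L*c1)).sub (i2.const_mul c2)
    have := setIntegral_mono_on j (hintg x hx) tailA_meas (fun y hy => by
      have hy' : R ≤ ‖y‖ := hy
      obtain ⟨k1, k2, k3⟩ := hker x y hx hy
      have hy0 : 0 < ‖y‖ := by linarith
      have hl := Real.log_nonneg (show 1 ≤ ‖y‖ by linarith)
      rw [div_eq_mul_one_div, sub_eq_add_neg τ a, Real.rpow_add hy0]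
      have q1 : ‖y‖^τ * L * (c1 * ‖y‖^(-a)) ≤ ‖y‖^τ * L * (1/‖x-y‖^a) :=
        mul_le_mul_of_nonneg_left k1 (by positivity)
      have q2 : ‖y‖^τ * Real.log ‖y‖ * (1/‖x-y‖^a) ≤ ‖y‖^τ * Real.log ‖y‖ * (c2 * ‖y‖^(-a)) :=
        mul_le_mul_of_nonneg_left k2 (by positivity)
      linarith)
    refine le_trans ?_ this
    have e := integral_sub (i1.const_mul (L*c1)) (i2.const_mul c2)
    rw [integral_const_mul, integral_const_mul, ← hI1d, ← hI2d] at e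
    refine le_trans ?_ (le_of_eq e.symm)
    have : c2 * I2 ≤ L * c1 * I1 := by linarith
    linarith
  · have hi := (hintg x hx).abs
    refine setIntegral_mono_on ?_ idom tailA_meas (hab x hx)
    refine IntegrableOn.congr_fun hi (fun y hy => ?_) tailA_meas
    show |_| = _
    rw [abs_div, abs_of_nonneg (a := ‖x-y‖^a) (by positivity)]

def PsiL (N : ℕ) (τ L R : ℝ) (x : EN N) : ℝ :=
  if ‖x‖ < R then ‖x‖^τ * (L - Real.log ‖x‖) else 0

lemma PsiL_measurable {N : ℕ} {τ L R : ℝ} : Measurable (PsiL N τ L R) := by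
  unfold PsiL
  exact Measurable.ite (measurableSet_lt measurable_norm measurable_const) (by fun_prop) measurable_const

lemma full_integrable {N : ℕ} (hN : 2 ≤ N) {τ L θ : ℝ} (h1 : -(N:ℝ) < τ) (h2 : τ < 0) (hθ : 0 < θ) (x : EN N) :
    Integrable (fun y : EN N => (‖y‖^τ * (L - Real.log ‖y‖)) * hk N θ (x-y)) := by
  refine (((pow_hk_integrable hN h1 h2 hθ x).const_mul L).add (lf_hk_integrable hN h1 h2 hθ x)).congr
    (ae_of_all _ fun y => ?_)
  simp only [Pi.add_apply, lf]; ring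

lemma PsiL_mul_eq {N : ℕ} {τ L R θ : ℝ} (x : EN N) : (fun y => PsiL N τ L R y * hk N θ (x-y)) =
    (tailA N R)ᶜ.indicator (fun y : EN N => (‖y‖^τ * (L - Real.log ‖y‖)) * hk N θ (x-y)) := by
  ext y
  by_cases h : ‖y‖ < R
  · rw [indicator_of_mem (by simpa [tailA] using h), PsiL, if_pos h]
  · rw [indicator_of_notMem (by simpa [tailA] using h), PsiL, if_neg h, zero_mul]

lemma PsiL_hk {N : ℕ} (hN : 2 ≤ N) {τ L R θ : ℝ} (h1 : -(N:ℝ) < τ) (h2 : τ < 0) (hθ : 0 < θ) (x : EN N) :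
    Integrable (fun y => PsiL N τ L R y * hk N θ (x-y)) := by
  rw [PsiL_mul_eq]
  exact (full_integrable hN h1 h2 hθ x).indicator tailA_meas.compl

lemma PsiL_Dop {N : ℕ} (hN : 2 ≤ N) {τ L R θ : ℝ} (h1 : -(N:ℝ) < τ) (h2 : τ < 0) (hθ : 0 < θ) {x : EN N}
    (hx : ‖x‖ < R) : Dop N (PsiL N τ L R) θ x = Dop N (lf N τ) θ x + L * Dop N (fun y => ‖y‖^τ) θ x
      + ∫ y in tailA N R, (‖y‖^τ * (L - Real.log ‖y‖)) * hk N θ (x-y) := by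
  have i1 := pow_hk_integrable hN h1 h2 hθ x
  have i2 := lf_hk_integrable hN h1 h2 hθ x
  have i3 := full_integrable (L := L) hN h1 h2 hθ x
  rw [Dop_eq hθ (PsiL_hk hN h1 h2 hθ x), Dop_eq hθ i1, Dop_eq hθ i2, PsiL_mul_eq,
    integral_indicator tailA_meas.compl]
  have e := integral_add_compl (tailA_meas (N := N) (R := R)) i3
  have e2 : ∫ y : EN N, (‖y‖^τ * (L - Real.log ‖y‖)) * hk N θ (x-y) =
      L * (∫ y : EN N, ‖y‖^τ * hk N θ (x-y)) + ∫ y, lf N τ y * hk N θ (x-y) := by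
    rw [← integral_const_mul, ← integral_add (i1.const_mul L) i2]
    congr 1; ext y; simp only [lf]; ring
  rw [e2] at e
  rw [PsiL, if_pos hx, lf]
  linear_combination -e

set_option maxHeartbeats 400000 in
lemma superSol_log {N : ℕ} (hN : 2 ≤ N) {s τ : ℝ} (hs : 0 < s) (hs1 : s < 1)
    (hτ : τ = (2*s-N)/2) {Ω : Set (EN N)}
    (hb : Bornology.IsBounded Ω) : ∃ Ψ, SuperSol N s (mu0 N s) τ Ω Ψ := by
  have hN' : (2:ℝ) ≤ N := by exact_mod_cast hN
  have h1 : -(N:ℝ) < τ := by rw [hτ]; linarith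
  have h2 : τ < 0 := by rw [hτ]; linarith
  have hder : HasDerivAt (csFun N s) 0 τ := by rw [hτ]; exact csFun_deriv hN hs hs1
  have hcs : csFun N s τ = -mu0 N s := by rw [hτ]; exact csFun_tau0 hs
  obtain ⟨R0, hR01, hR0⟩ := exists_R hb
  obtain ⟨R, hRd⟩ : ∃ R, R = 2 * R0 := ⟨_, rfl⟩
  have hR1 : 1 ≤ R := by linarith
  obtain ⟨L, C, hL, hT⟩ := tail_main hN hR1 hs h2
  have hR' : ∀ x ∈ Ω, ‖x‖ < R0 := fun x hx => by simpa using hR0 (subset_closure hx)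
  have hlogR := Real.log_nonneg hR1
  have hcont : ∀ a : ℝ, ContinuousOn (fun t : ℝ => t^a) (Ioi 0) := fun a t ht =>
    (Real.continuousAt_rpow_const t a (Or.inl (ne_of_gt ht))).continuousWithinAt
  have hclog : ContinuousOn Real.log (Ioi 0) := fun t ht =>
    (Real.continuousAt_log (ne_of_gt ht)).continuousWithinAt
  have hPsi : ∀ x : EN N, ‖x‖ < R → PsiL N τ L R x = ‖x‖^τ * (L - Real.log ‖x‖) := fun x hx => by
    rw [PsiL, if_pos hx]
  have hlog : ∀ t, 0 < t → t < R → 1 ≤ L - Real.log t := fun t ht htR => by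
    have := Real.log_le_log ht htR.le; linarith
  obtain ⟨h0, hh0, h3, h4⟩ := exists_h h1 h2
  have hx0 : ∀ x : EN N, x ≠ 0 → ∀ᵐ y ∂(volume.restrict (tailA N R)), x ∈ Ω → x - y ≠ 0 := by
    intro x hx
    filter_upwards [ae_restrict_mem tailA_meas] with y hy hxΩ
    have hy : R ≤ ‖y‖ := hy
    rw [sub_ne_zero]
    rintro rfl
    have := hR' _ hxΩ; linarith
  have tailI : ∀ x ∈ Ω, x ≠ 0 → IntegrableOn (fun θ : ℝ => θ^(-1-s) * ∫ y in tailA N R,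
      (‖y‖^τ * (L - Real.log ‖y‖)) * hk N θ (x-y)) (Ioi 0) ∧
      ∫ θ in Ioi (0:ℝ), θ^(-1-s) * ∫ y in tailA N R, (‖y‖^τ * (L - Real.log ‖y‖)) * hk N θ (x-y) =
      Real.Gamma ((N:ℝ)/2+s) * ∫ y in tailA N R, (‖y‖^τ * (L - Real.log ‖y‖)) / ‖x-y‖^((N:ℝ)+2*s) := by
    intro x hx hx'
    exact theta_fubini_integral (ν := volume.restrict (tailA N R)) hN hs (z := fun y => x - y) (by fun_prop)
      (by filter_upwards [hx0 x hx'] with y hy using hy hx) (hT x (by linarith [hR' x hx])).1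
  have tailB : ∀ x ∈ Ω, x ≠ 0 → ∫ θ in Ioi (0:ℝ), |θ^(-1-s) * ∫ y in tailA N R,
      (‖y‖^τ * (L - Real.log ‖y‖)) * hk N θ (x-y)| ≤ Real.Gamma ((N:ℝ)/2+s) * C := by
    intro x hx hx'
    have := theta_fubini_abs (ν := volume.restrict (tailA N R)) hN hs (z := fun y => x - y) (by fun_prop)
      (by filter_upwards [hx0 x hx'] with y hy using hy hx) (hT x (by linarith [hR' x hx])).1
    refine this.trans ?_
    have := Real.Gamma_pos_of_pos (show 0 < (N:ℝ)/2+s by positivity)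
    have := (hT x (by linarith [hR' x hx])).2.2
    gcongr
  have deq : ∀ x ∈ Ω, ∀ θ ∈ Ioi (0:ℝ), θ^(-1-s) * Dop N (PsiL N τ L R) θ x =
      (θ^(-1-s) * Dop N (lf N τ) θ x + L * (θ^(-1-s) * Dop N (fun y => ‖y‖^τ) θ x))
      + θ^(-1-s) * ∫ y in tailA N R, (‖y‖^τ * (L - Real.log ‖y‖)) * hk N θ (x-y) := by
    intro x hx θ hθ
    rw [PsiL_Dop hN h1 h2 hθ (by linarith [hR' x hx])]; ring
  have i1 : ∀ x : EN N, x ≠ 0 → _ := fun x hx => powD_integrable hN hs hs1 h1 h2 hx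
  have i2 : ∀ x : EN N, x ≠ 0 → _ := fun x hx => logD_integrable hN hs hs1 h1 h2 hh0 h3 h4 hx
  have hDI : ∀ x ∈ Ω, x ≠ 0 → IntegrableOn (fun θ => θ^(-1-s) * Dop N (PsiL N τ L R) θ x) (Ioi 0) := by
    intro x hx hx'
    refine IntegrableOn.congr_fun ?_ (fun θ hθ => (deq x hx θ hθ).symm) measurableSet_Ioi
    exact ((i2 x hx').1.add ((i1 x hx').const_mul L)).add (tailI x hx hx').1
  have hκ : 0 < CNs N s / Real.Gamma ((N:ℝ)/2+s) := by
    have := Real.Gamma_pos_of_pos (show 0 < (N:ℝ)/2+s by positivity)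
    have := Real.Gamma_pos_of_pos (show 0 < 1 - s by linarith)
    have := Real.Gamma_pos_of_pos (show 0 < ((N:ℝ)+2*s)/2 by positivity)
    unfold CNs; positivity
  refine ⟨PsiL N τ L R, ?_⟩
  constructor
  · exact PsiL_measurable
  · intro x
    unfold PsiL
    split_ifs with h
    · rcases eq_or_ne x 0 with rfl | hx
      · simp [Real.zero_rpow h2.ne]
      · have := hlog ‖x‖ (norm_pos_iff.2 hx) h
        have : 0 ≤ L - Real.log ‖x‖ := by linarith
        positivity
    · exact le_rfl
  · intro δ hδ
    refine ⟨R^τ, by positivity, fun x hx hx' => ?_⟩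
    have hxR := hR' x hx
    rw [hPsi x (by linarith)]
    have a := hlog ‖x‖ (by linarith) (by linarith)
    have b : R^τ ≤ ‖x‖^τ := Real.rpow_le_rpow_of_nonpos (by linarith) (by linarith) h2.le
    have : 0 < R^τ := by positivity
    nlinarith
  · intro δ hδ
    obtain ⟨C, hC⟩ := bdd_radial (φ := fun t => t^τ * (L - Real.log t)) 
      ((hcont _).mul (continuousOn_const.sub hclog)) (R := R) hδ
    refine ⟨C, fun x hx hx' => ?_⟩
    have hxR := hR' x hx
    rw [hPsi x (by linarith)]
    exact hC _ hx' (by linarith)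
  · refine ⟨R0, hR0, fun δ hδ => ?_⟩
    obtain ⟨K, hK, h⟩ := lip_radial (N := N) (φ := fun t => t^τ * (L - Real.log t))
      (φ' := fun t => (τ * t^(τ-1)) * (L - Real.log t) + t^τ * (0 - t⁻¹))
      (fun t ht => (Real.hasDerivAt_rpow_const (Or.inl ht.ne')).mul
        ((hasDerivAt_const t L).sub (Real.hasDerivAt_log ht.ne')))
      (((continuousOn_const.mul (hcont _)).mul (continuousOn_const.sub hclog)).add
        ((hcont _).mul (continuousOn_const.sub (continuousOn_inv₀.mono fun t ht => ne_of_gt ht))))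
      (R := R) hδ
    refine ⟨K, hK, fun x y a b c d => ?_⟩
    rw [hPsi x (by linarith), hPsi y (by linarith)]
    exact h x y a (by linarith) c (by linarith)
  · intro x _ _ θ hθ; exact PsiL_hk hN h1 h2 hθ x
  · exact hDI
  · intro δ hδ
    obtain ⟨C0, hC0⟩ := powD_abs hN hs hs1 h1 h2
    obtain ⟨C1, hC1⟩ := powD_abs hN hs hs1 (τ := τ+h0) (by linarith) h4
    obtain ⟨C2, hC2⟩ := powD_abs hN hs hs1 (τ := τ-h0) h3 (by linarith)
    obtain ⟨C3, hC3⟩ := bdd_radial (φ := fun t => (1/h0) * (2 * ((1 + h0 * |Real.log t|) * (C0 * t^(τ-2*s)))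
      + t^(-h0) * (C1 * t^(τ+h0-2*s)) + t^h0 * (C2 * t^(τ-h0-2*s))) + L * (C0 * t^(τ-2*s))) (R := R)
      (by
        have := hclog.abs
        have a := hcont (τ-2*s)
        have b := hcont (τ+h0-2*s)
        have c := hcont (τ-h0-2*s)
        have d := hcont h0
        have e := hcont (-h0)
        fun_prop) hδ
    refine ⟨C3 + Real.Gamma ((N:ℝ)/2+s) * C, fun x hx hx' => ?_⟩
    have hxn := ne_zero_of_le hδ hx'
    have hxp := norm_pos_iff.2 hxn
    have j1 := (i2 x hxn).1.abs
    have j2 := ((i1 x hxn).abs.const_mul L)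
    have j3 := (tailI x hx hxn).1.abs
    have hle : ∀ θ ∈ Ioi (0:ℝ), |θ^(-1-s) * Dop N (PsiL N τ L R) θ x| ≤ 
      (|θ^(-1-s) * Dop N (lf N τ) θ x| + L * |θ^(-1-s) * Dop N (fun y => ‖y‖^τ) θ x|)
      + |θ^(-1-s) * ∫ y in tailA N R, (‖y‖^τ * (L - Real.log ‖y‖)) * hk N θ (x-y)| := by
      intro θ hθ
      rw [deq x hx θ hθ]
      refine (abs_add_le _ _).trans ?_
      gcongr
      refine (abs_add_le _ _).trans ?_
      rw [abs_mul L, abs_of_nonneg (show 0 ≤ L by linarith)]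
    refine (setIntegral_mono_on (hDI x hx hxn).abs ((j1.add j2).add j3) measurableSet_Ioi hle).trans ?_
    refine (le_of_eq (integral_add (j1.add j2) j3)).trans ?_
    refine add_le_add ?_ (tailB x hx hxn)
    refine (le_of_eq (integral_add j1 j2)).trans ?_
    rw [integral_const_mul]
    refine le_trans ?_ (hC3 ‖x‖ hx' (by linarith [hR' x hx]))
    have k := (i2 x hxn).2
    have k0 := hC0 x hxn
    have k1 := hC1 x hxn
    have k2 := hC2 x hxn
    refine add_le_add (k.trans ?_) ?_
    · gcongr
    · have : 0 ≤ L := by linarith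
      gcongr
  · intro x hx hxn
    have hxp := norm_pos_iff.2 hxn
    rw [setIntegral_congr_fun measurableSet_Ioi (deq x hx)]
    have j1 := (i2 x hxn).1
    have j2 := ((i1 x hxn).const_mul L)
    have j3 := (tailI x hx hxn).1
    have e := (integral_add (j1.add j2) j3).trans (congrArg (· + _) (integral_add j1 j2))
    rw [(tailI x hx hxn).2, integral_const_mul] at e
    simp only [Pi.add_apply] at e
    rw [e]
    have k1 := logD_super hN hs hs1 h1 h2 hder hxn
    have k2 := powD_integral hN hs hs1 h1 h2 hxn
    have k3 : 0 ≤ CNs N s / Real.Gamma ((N:ℝ)/2+s) * (Real.Gamma ((N:ℝ)/2+s) * ∫ y in tailA N R, (‖y‖^τ * (L - Real.log ‖y‖)) / ‖x-y‖^((N:ℝ)+2*s)) := by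
      have := Real.Gamma_pos_of_pos (show 0 < (N:ℝ)/2+s by positivity)
      have h3 := (hT x (by linarith [hR' x hx])).2.1
      exact mul_nonneg hκ.le (mul_nonneg this.le h3)
    rw [hPsi x (by linarith [hR' x hx])]
    rw [hcs, Real.rpow_sub hxp] at k1 k2
    have e3 : mu0 N s * (‖x‖^τ * (L - Real.log ‖x‖) / ‖x‖^(2*s)) =
       - (-mu0 N s * (-(‖x‖^τ/‖x‖^(2*s) * Real.log ‖x‖))) - L * (-mu0 N s * (‖x‖^τ/‖x‖^(2*s))) := by ring
    rw [e3, ← k2]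
    linarith
  · refine ⟨1, one_pos, ?_⟩
    have : ball (0:EN N) 1 ∈ 𝓝[≠] (0:EN N) := mem_nhdsWithin_of_mem_nhds (ball_mem_nhds _ one_pos)
    filter_upwards [self_mem_nhdsWithin, this] with x hx hx1
    have hxp := norm_pos_iff.2 hx
    have hx1 : ‖x‖ < 1 := by simpa using hx1
    have hl := Real.log_neg hxp hx1
    rw [Phi, if_pos rfl, hPsi x (by linarith)]
    have hp : 0 < ‖x‖^τ := by positivity
    constructor
    · have := mul_pos_of_neg_of_neg (neg_neg_of_pos hp) hl; linarith
    · have : 0 ≤ ‖x‖^τ * L := mul_nonneg hp.le (by linarith)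
      linarith

lemma exists_superSol {N : ℕ} (hN : 2 ≤ N) {s μ τ : ℝ} (hs : 0 < s) (hs1 : s < 1)
    (hτ : τ ∈ Ioc (-(N:ℝ)) ((2*s - N)/2)) (hc : csFun N s τ = -μ) {Ω : Set (EN N)}
    (hb : Bornology.IsBounded Ω) : ∃ Ψ, SuperSol N s μ τ Ω Ψ := by
  have hN' : (2:ℝ) ≤ N := by exact_mod_cast hN
  have h2 : τ < 0 := by linarith [hτ.2]
  by_cases h : μ = mu0 N s
  · have : τ = (2*s-N)/2 := by
      by_contra hne
      have := csFun_lt hN hs hs1 hτ.1 (by linarith) hne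
      rw [hc, csFun_tau0 hs, h] at this
      exact lt_irrefl _ this
    rw [h]
    exact superSol_log hN hs hs1 this hb
  · exact ⟨_, superSol_pow hN hs hs1 hτ.1 h2 hc h hb⟩

lemma ae_diag {N : ℕ} (hN : 2 ≤ N) : ∀ᵐ p : EN N × EN N, p.1 - p.2 ≠ 0 := by
  have hm : MeasurableSet {p : EN N × EN N | p.1 - p.2 ≠ 0} :=
    (measurable_fst.sub measurable_snd) (measurableSet_singleton (0 : EN N)).compl
  rw [Measure.volume_eq_prod, Measure.ae_prod_iff_ae_ae hm]
  refine ae_of_all _ fun x => ?_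
  have : Nontrivial (EN N) := by
    have : Nonempty (Fin N) := ⟨⟨0, by omega⟩⟩
    infer_instance
  have := (measure_singleton (μ := (volume : Measure (EN N))) x)
  have h2 : ∀ᵐ y : EN N, y ≠ x := by
    rw [ae_iff]; simp
  filter_upwards [h2] with y hy
  exact sub_ne_zero.2 (Ne.symm hy)

/-- Joint integrability of `g(x) θ^(-1-s) D_θ Ψ(x)`. -/
lemma gD_joint {N : ℕ} {s μ τ : ℝ} {Ω : Set (EN N)} {Ψ : EN N → ℝ}
    (hΨ : SuperSol N s μ τ Ω Ψ) {δ : ℝ} (hδ : 0 < δ) {g : EN N → ℝ} (hg : Integrable g)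
    (hgS : ∀ x, g x ≠ 0 → x ∈ Ω ∧ δ ≤ ‖x‖) :
    Integrable (fun q : ℝ × EN N => g q.2 * (q.1^(-1-s) * Dop N Ψ q.1 q.2))
      ((volume.restrict (Ioi 0)).prod volume) := by
  have hm : AEStronglyMeasurable (fun q : ℝ × EN N => g q.2 * (q.1^(-1-s) * Dop N Ψ q.1 q.2))
      ((volume.restrict (Ioi 0)).prod volume) := by
    refine AEStronglyMeasurable.mul ?_ ?_
    · exact hg.1.comp_quasiMeasurePreserving Measure.quasiMeasurePreserving_snd
    · have := Dop_measurable hΨ.meas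
      exact Measurable.aestronglyMeasurable (Measurable.mul (by fun_prop) this)
  rw [integrable_prod_iff' hm]
  obtain ⟨C, hC⟩ := hΨ.dabs δ hδ
  refine ⟨ae_of_all _ fun x => ?_, ?_⟩
  · by_cases h : g x = 0
    · simp [h]
    · obtain ⟨h1, h2⟩ := hgS x h
      exact (hΨ.dint x h1 (ne_zero_of_le hδ h2)).const_mul (g x)
  · refine Integrable.mono' (hg.abs.const_mul C) hm.norm.prod_swap.integral_prod_right' (ae_of_all _ fun x => ?_)
    simp only [norm_mul (g x), integral_const_mul]
    by_cases h : g x = 0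
    · simp [h]
    · obtain ⟨h1, h2⟩ := hgS x h
      have := hC x h1 h2
      simp only [Real.norm_eq_abs, abs_mul, abs_abs] at *
      rw [mul_comm, abs_of_nonneg (integral_nonneg fun θ => mul_nonneg (abs_nonneg (θ^(-1-s))) (abs_nonneg (Dop N Ψ θ x)))]
      gcongr

lemma sym_int {N : ℕ} {s μ τ : ℝ} {Ω : Set (EN N)} {Ψ : EN N → ℝ}
    (hΨ : SuperSol N s μ τ Ω Ψ) {δ : ℝ} (hδ : 0 < δ) {g : EN N → ℝ} (hg : Integrable g)
    (hgS : ∀ x, g x ≠ 0 → x ∈ Ω ∧ δ ≤ ‖x‖) {θ : ℝ} (hθ : 0 < θ)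
    (hD : Integrable (fun x => g x * Dop N Ψ θ x)) :
    Integrable (fun p : EN N × EN N => (Ψ p.1 - Ψ p.2) * (g p.1 - g p.2) * hk N θ (p.1 - p.2)) ∧
    ∫ p : EN N × EN N, (Ψ p.1 - Ψ p.2) * (g p.1 - g p.2) * hk N θ (p.1 - p.2) =
      2 * ∫ x, g x * Dop N Ψ θ x := by
  have hkm : Measurable (fun p : EN N × EN N => hk N θ (p.1 - p.2)) := by unfold hk; fun_prop
  have hΨm := hΨ.meas
  have hm : AEStronglyMeasurable (fun p : EN N × EN N => g p.1 * ((Ψ p.1 - Ψ p.2) * hk N θ (p.1 - p.2)))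
      (volume.prod volume) := by
    refine AEStronglyMeasurable.mul ?_ ?_
    · exact hg.1.comp_quasiMeasurePreserving Measure.quasiMeasurePreserving_fst
    · exact Measurable.aestronglyMeasurable (Measurable.mul (by fun_prop) hkm)
  obtain ⟨C, hC⟩ := hΨ.upper δ hδ
  have hgΨ : Integrable (fun x => g x * Ψ x) := by
    refine Integrable.mono' (hg.abs.const_mul C) (hg.1.mul hΨm.aestronglyMeasurable) (ae_of_all _ fun x => ?_)
    by_cases h : g x = 0
    · simp [h]
    · obtain ⟨h1, h2⟩ := hgS x h
      rw [norm_mul, Real.norm_eq_abs, Real.norm_eq_abs, abs_of_nonneg (hΨ.nonneg x), mul_comm]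
      have := hC x h1 h2
      gcongr
  have hi1 : ∀ x, g x ≠ 0 → Integrable (fun y => (Ψ x - Ψ y) * hk N θ (x - y)) := by
    intro x h
    obtain ⟨h1, h2⟩ := hgS x h
    simp_rw [sub_mul]
    exact ((hk_comp_sub_integrable N hθ x).const_mul _).sub (hΨ.hkint x h1 (ne_zero_of_le hδ h2) θ hθ)
  have ha : Integrable (fun p : EN N × EN N => g p.1 * ((Ψ p.1 - Ψ p.2) * hk N θ (p.1 - p.2)))
      (volume.prod volume) := by
    rw [integrable_prod_iff hm]
    refine ⟨ae_of_all _ fun x => ?_, ?_⟩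
    · by_cases h : g x = 0
      · simp [h]
      · exact (hi1 x h).const_mul (g x)
    · refine Integrable.mono' ((hgΨ.abs.const_mul (2 * Real.pi^((N:ℝ)/2))).add hD.abs)
        hm.norm.integral_prod_right' (ae_of_all _ fun x => ?_)
      by_cases h : g x = 0
      · simp [h]
      · obtain ⟨h1, h2⟩ := hgS x h
        have hh := hΨ.hkint x h1 (ne_zero_of_le hδ h2) θ hθ
        have e := Dop_eq hθ hh
        have b : ∫ y, ‖g x * ((Ψ x - Ψ y) * hk N θ (x - y))‖ ≤
            ∫ y, |g x| * (Ψ x * hk N θ (x-y) + Ψ y * hk N θ (x - y)) := by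
          refine integral_mono ((hi1 x h).const_mul _).norm
            ((((hk_comp_sub_integrable N hθ x).const_mul _).add hh).const_mul _) fun y => ?_
          simp only [norm_mul, Real.norm_eq_abs]
          rw [← add_mul, abs_of_nonneg (hk_nonneg N hθ.le (x-y))]
          have q1 := hΨ.nonneg x
          have q2 := hΨ.nonneg y
          have q3 := hk_nonneg N hθ.le (x-y)
          have : |Ψ x - Ψ y| ≤ Ψ x + Ψ y := abs_le.2 ⟨by linarith, by linarith⟩
          gcongr
        rw [integral_const_mul] at b
        have e2 := (integral_add ((hk_comp_sub_integrable N hθ x).const_mul (Ψ x)) hh)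
        rw [integral_const_mul, hk_comp_sub_integral N hθ] at e2
        rw [e2] at b
        rw [Real.norm_eq_abs, abs_of_nonneg (integral_nonneg fun _ => norm_nonneg _)]
        refine b.trans ?_
        simp only [Pi.add_apply, abs_mul, abs_of_nonneg (hΨ.nonneg x)]
        have e3 : ∫ y, Ψ y * hk N θ (x - y) = Real.pi^((N:ℝ)/2) * Ψ x - Dop N Ψ θ x := by linarith
        rw [e3]
        have := mul_le_mul_of_nonneg_left (neg_le_abs (Dop N Ψ θ x)) (abs_nonneg (g x))
        linarith
  have hb := ha.swap
  have eq : ∀ p : EN N × EN N, (Ψ p.1 - Ψ p.2) * (g p.1 - g p.2) * hk N θ (p.1 - p.2) =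
     g p.1 * ((Ψ p.1 - Ψ p.2) * hk N θ (p.1 - p.2)) +
      ((fun p : EN N × EN N => g p.1 * ((Ψ p.1 - Ψ p.2) * hk N θ (p.1 - p.2))) ∘ Prod.swap) p := by
    intro p
    simp only [Function.comp, Prod.fst_swap, Prod.snd_swap]
    rw [hk_sub_comm N θ p.2 p.1]; ring
  simp_rw [eq]
  refine ⟨ha.add hb, (integral_add ha hb).trans ?_⟩
  have e1 : ∫ p : EN N × EN N, g p.1 * ((Ψ p.1 - Ψ p.2) * hk N θ (p.1 - p.2)) = ∫ x, g x * Dop N Ψ θ x := by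
    rw [Measure.volume_eq_prod, integral_prod _ ha]
    refine integral_congr_ae (ae_of_all _ fun x => ?_)
    simp only [integral_const_mul, Dop]
  have e2 : ∫ p : EN N × EN N, ((fun p : EN N × EN N => g p.1 * ((Ψ p.1 - Ψ p.2) * hk N θ (p.1 - p.2))) ∘ Prod.swap) p =
      ∫ x, g x * Dop N Ψ θ x := by
    rw [← e1, Measure.volume_eq_prod]
    exact integral_prod_swap (μ := (volume : Measure (EN N))) (ν := (volume : Measure (EN N))) (fun p : EN N × EN N => g p.1 * ((Ψ p.1 - Ψ p.2) * hk N θ (p.1 - p.2)))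
  rw [Measure.volume_eq_prod] at e1 e2
  rw [e1, e2]; ring

lemma CNs_pos {N : ℕ} {s : ℝ} (hs : 0 < s) (hs1 : s < 1) : 0 < CNs N s := by
  have := Real.Gamma_pos_of_pos (show 0 < 1 - s by linarith)
  have := Real.Gamma_pos_of_pos (show 0 < ((N:ℝ)+2*s)/2 by positivity)
  unfold CNs; positivity

lemma mainB {N : ℕ} (hN : 2 ≤ N) {s μ τ : ℝ} (hs : 0 < s) (hs1 : s < 1) {Ω : Set (EN N)} {Ψ : EN N → ℝ}
    (hΨ : SuperSol N s μ τ Ω Ψ) {δ : ℝ} (hδ : 0 < δ) {g : EN N → ℝ} (hg : Integrable g)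
    (hg0 : ∀ x, 0 ≤ g x)
    (hgS : ∀ x, g x ≠ 0 → x ∈ Ω ∧ δ ≤ ‖x‖) {F : EN N × EN N → ℝ}
    (hF : Integrable (fun p : EN N × EN N => F p / dist p.1 p.2 ^ ((N:ℝ)+2*s)))
    (hP : ∀ᵐ p : EN N × EN N, 0 ≤ -F p - (Ψ p.1 - Ψ p.2) * (g p.1 - g p.2))
    (hE : 0 ≤ CNs N s / 2 * (∫ p : EN N × EN N, F p / dist p.1 p.2 ^ ((N:ℝ)+2*s))
      - μ * ∫ x, g x * (Ψ x / ‖x‖^(2*s))) :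
    ∀ᵐ p : EN N × EN N, -F p - (Ψ p.1 - Ψ p.2) * (g p.1 - g p.2) = 0 := by
  have hJ := gD_joint hΨ hδ hg hgS
  simp_rw [dist_eq_norm] at hF hE
  have hzm : Measurable (fun p : EN N × EN N => p.1 - p.2) := by fun_prop
  obtain ⟨t1, t2⟩ := theta_fubini_integral hN hs hzm (ae_diag hN) hF
  have t3 := theta_fubini_ae hN hs hzm (ae_diag hN) hF
  -- the g side
  have e0 : ∀ θ : ℝ, θ^(-1-s) * ∫ x, g x * Dop N Ψ θ x = ∫ x, g x * (θ^(-1-s) * Dop N Ψ θ x) := by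
    intro θ
    rw [← integral_const_mul]; congr 1; ext x; ring
  have g1 : IntegrableOn (fun θ : ℝ => θ^(-1-s) * ∫ x, g x * Dop N Ψ θ x) (Ioi 0) := by
    simp_rw [e0]; exact hJ.integral_prod_left
  have g2 : ∫ θ in Ioi (0:ℝ), θ^(-1-s) * ∫ x, g x * Dop N Ψ θ x =
      ∫ x, g x * ∫ θ in Ioi (0:ℝ), θ^(-1-s) * Dop N Ψ θ x := by
    simp_rw [e0]
    rw [integral_integral_swap (f := fun θ x => g x * (θ^(-1-s) * Dop N Ψ θ x)) hJ]
    simp_rw [integral_const_mul]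
  have g3 : ∀ᵐ θ ∂(volume.restrict (Ioi (0:ℝ))), Integrable (fun x => g x * Dop N Ψ θ x) := by
    filter_upwards [hJ.prod_right_ae, ae_restrict_mem measurableSet_Ioi] with θ hθ hpos
    have hpos : 0 < θ := hpos
    have := hθ.const_mul (θ^(-1-s))⁻¹
    refine this.congr (ae_of_all _ fun y => ?_)
    simp only
    rw [mul_left_comm (g y), ← mul_assoc, inv_mul_cancel₀ (by positivity), one_mul]
  have gH : Integrable (fun x => g x * ∫ θ in Ioi (0:ℝ), θ^(-1-s) * Dop N Ψ θ x) := by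
    have := hJ.integral_prod_right
    simp_rw [integral_const_mul] at this
    exact this
  have gW : Integrable (fun x => g x * (Ψ x / ‖x‖^(2*s))) := by
    obtain ⟨C, hC⟩ := hΨ.upper δ hδ
    have hΨm := hΨ.meas
    refine Integrable.mono' (hg.abs.const_mul (C/δ^(2*s))) (hg.1.mul (Measurable.aestronglyMeasurable (by fun_prop))) (ae_of_all _ fun x => ?_)
    by_cases h : g x = 0
    · simp [h]
    · obtain ⟨h1, h2⟩ := hgS x h
      have q := hΨ.nonneg x
      rw [norm_mul, Real.norm_eq_abs, Real.norm_eq_abs, abs_of_nonneg (a := Ψ x / _) (by positivity), mul_comm]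
      have := hC x h1 h2
      have : 0 ≤ C := q.trans this
      gcongr
  have key : ∀ᵐ θ ∂(volume.restrict (Ioi (0:ℝ))), 0 < θ ∧
      Integrable (fun p : EN N × EN N => (-F p - (Ψ p.1 - Ψ p.2) * (g p.1 - g p.2)) * hk N θ (p.1 - p.2)) ∧
      ∫ p : EN N × EN N, (-F p - (Ψ p.1 - Ψ p.2) * (g p.1 - g p.2)) * hk N θ (p.1 - p.2) =
        -(∫ p : EN N × EN N, F p * hk N θ (p.1 - p.2)) - 2 * ∫ x, g x * Dop N Ψ θ x := by
    filter_upwards [t3, g3, ae_restrict_mem measurableSet_Ioi] with θ h1 h2 hpos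
    have hpos : 0 < θ := hpos
    obtain ⟨h3, h4⟩ := sym_int hΨ hδ hg hgS hpos h2
    have e : (fun p : EN N × EN N => (-F p - (Ψ p.1 - Ψ p.2) * (g p.1 - g p.2)) * hk N θ (p.1 - p.2)) =
       fun p => -(F p * hk N θ (p.1 - p.2)) - (Ψ p.1 - Ψ p.2) * (g p.1 - g p.2) * hk N θ (p.1 - p.2) := by
      ext p; ring
    rw [e]
    refine ⟨hpos, h1.neg.sub h3, (integral_sub h1.neg h3).trans ?_⟩
    rw [h4]
    congr 1
    exact integral_neg _
  set A : ℝ → ℝ := fun θ => -(∫ p : EN N × EN N, F p * hk N θ (p.1 - p.2)) - 2 * ∫ x, g x * Dop N Ψ θ x with hA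
  have hA0 : ∀ᵐ θ ∂(volume.restrict (Ioi (0:ℝ))), 0 ≤ θ^(-1-s) * A θ := by
    filter_upwards [key] with θ hk3
    obtain ⟨h1, h2, h3⟩ := hk3
    refine mul_nonneg (by positivity) ?_
    rw [hA]; simp only; rw [← h3]
    refine integral_nonneg_of_ae ?_
    filter_upwards [hP] with p hp
    exact mul_nonneg hp (hk_nonneg N h1.le _)
  have eA : (fun θ : ℝ => θ^(-1-s) * A θ) = fun θ => -(θ^(-1-s) * ∫ p : EN N × EN N, F p * hk N θ (p.1 - p.2)) -
      2 * (θ^(-1-s) * ∫ x, g x * Dop N Ψ θ x) := by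
    ext θ; rw [hA]; ring
  have iA : IntegrableOn (fun θ : ℝ => θ^(-1-s) * A θ) (Ioi 0) := by
    rw [eA]; exact t1.neg.sub (g1.const_mul 2)
  have vA : ∫ θ in Ioi (0:ℝ), θ^(-1-s) * A θ =
      -(Real.Gamma ((N:ℝ)/2+s) * ∫ p : EN N × EN N, F p / ‖p.1 - p.2‖^((N:ℝ)+2*s)) -
        2 * ∫ x, g x * ∫ θ in Ioi (0:ℝ), θ^(-1-s) * Dop N Ψ θ x := by
    rw [eA]
    refine (integral_sub t1.neg (g1.const_mul 2)).trans ?_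
    rw [integral_const_mul, g2, ← t2]
    congr 1
    exact integral_neg _
  have hG := Real.Gamma_pos_of_pos (show 0 < (N:ℝ)/2+s by positivity)
  have hCN := CNs_pos (N := N) hs hs1
  have cmp : 0 ≤ CNs N s / Real.Gamma ((N:ℝ)/2+s) * (∫ x, g x * ∫ θ in Ioi (0:ℝ), θ^(-1-s) * Dop N Ψ θ x) +
      μ * ∫ x, g x * (Ψ x / ‖x‖^(2*s)) := by
    rw [← integral_const_mul, ← integral_const_mul]
    refine le_of_le_of_eq ?_ (integral_add (gH.const_mul _) (gW.const_mul _))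
    refine integral_nonneg fun x => ?_
    simp only [Pi.zero_apply]
    by_cases h : g x = 0
    · simp [h]
    · obtain ⟨h1, h2⟩ := hgS x h
      have := mul_nonneg (hg0 x) (hΨ.super x h1 (ne_zero_of_le hδ h2))
      linarith
  have zA : ∫ θ in Ioi (0:ℝ), θ^(-1-s) * A θ ≤ 0 := by
    rw [vA]
    clear * - cmp hE hG hCN
    generalize (∫ x, g x * ∫ θ in Ioi (0:ℝ), θ^(-1-s) * Dop N Ψ θ x) = X at *
    generalize (∫ x, g x * (Ψ x / ‖x‖^(2*s))) = Z at *
    generalize (∫ p : EN N × EN N, F p / ‖p.1 - p.2‖^((N:ℝ)+2*s)) = Y at *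
    generalize Real.Gamma ((N:ℝ)/2+s) = G at *
    generalize CNs N s = c at *
    have h := add_nonneg cmp hE
    have h2 : c / (2 * G) * (-(G*Y) - 2*X) = -(c/G*X + μ*Z + (c/2*Y - μ*Z)) := by
      field_simp; ring
    have h3 : 0 < c/(2*G) := by positivity
    by_contra hcon
    push Not at hcon
    have := mul_pos h3 hcon
    linarith
  have z0 : (fun θ : ℝ => θ^(-1-s) * A θ) =ᵐ[volume.restrict (Ioi 0)] 0 := by
    rw [← integral_eq_zero_iff_of_nonneg_ae hA0 iA]
    exact le_antisymm zA (integral_nonneg_of_ae hA0)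
  have hne : (ae (volume.restrict (Ioi (0:ℝ)))).NeBot := by
    rw [ae_neBot]
    intro h
    have := congrArg (fun m => m univ) h
    simp at this
  obtain ⟨θ, ⟨h1, h2, h3⟩, h4⟩ := (key.and z0).exists
  have h5 : A θ = 0 := by
    have : θ^(-1-s) ≠ 0 := by positivity
    simpa [this] using h4
  have h6 : ∫ p : EN N × EN N, (-F p - (Ψ p.1 - Ψ p.2) * (g p.1 - g p.2)) * hk N θ (p.1 - p.2) = 0 := by
    rw [h3]; exact h5
  rw [integral_eq_zero_iff_of_nonneg_ae ?_ h2] at h6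
  · filter_upwards [h6] with p hp
    have := (hk_pos N h1 (p.1 - p.2)).ne'
    simpa [this] using hp
  · filter_upwards [hP] with p hp
    exact mul_nonneg hp (hk_nonneg N h1.le _)

lemma MemL1w.aesm {N : ℕ} {s : ℝ} {u : EN N → ℝ} (hu : MemL1w N s u) : AEStronglyMeasurable u := by
  have h : AEStronglyMeasurable (fun x : EN N => (u x / (1 + ‖x‖ ^ ((N:ℝ) + 2*s))) * (1 + ‖x‖ ^ ((N:ℝ) + 2*s))) :=
    hu.1.mul (Measurable.aestronglyMeasurable (by fun_prop))
  refine h.congr (ae_of_all _ fun x => ?_)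
  simp only
  rw [div_mul_cancel₀]
  positivity

lemma weight_integrable {N : ℕ} {s : ℝ} (hs : 0 < s) :
    Integrable (fun y : EN N => 1 / (1 + ‖y‖ ^ ((N:ℝ) + 2*s))) := by
  obtain ⟨a, ha⟩ : ∃ a, a = (N:ℝ) + 2*s := ⟨_, rfl⟩
  rw [← ha]
  have ha0 : 0 < a := by rw [ha]; positivity
  have h := integrable_one_add_norm (E := EN N) (μ := volume) (r := a) (by
    simp [ha, hs])
  refine Integrable.mono' (h.const_mul (2^a)) (Measurable.aestronglyMeasurable (by fun_prop)) (ae_of_all _ fun y => ?_)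
  rw [Real.norm_eq_abs, abs_of_nonneg (by positivity), Real.rpow_neg (by positivity), ← div_eq_mul_inv,
    div_le_div_iff₀ (by positivity) (by positivity), one_mul]
  have hy := norm_nonneg y
  rcases le_total ‖y‖ 1 with h1 | h1
  · have : (1+‖y‖)^a ≤ 2^a := by
      gcongr; linarith
    have h2 : 0 ≤ (2:ℝ)^a * ‖y‖^a := by positivity
    linarith
  · have : (1+‖y‖)^a ≤ 2^a * ‖y‖^a := by
      rw [← Real.mul_rpow (by norm_num) hy]
      gcongr; linarith
    have h2 : 0 ≤ (2:ℝ)^a := by positivity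
    linarith

lemma sym_ext {N : ℕ} {S : Set (EN N)} (hS : MeasurableSet S) {G : EN N × EN N → ℝ}
    (hsym : ∀ p, G p.swap = G p) (h0 : ∀ p, p.1 ∉ S → p.2 ∉ S → G p = 0)
    (h : IntegrableOn G (S ×ˢ univ)) : Integrable G := by
  have h2 : IntegrableOn G (univ ×ˢ S) := by
    have := IntegrableOn.swap (μ := (volume : Measure (EN N))) (ν := (volume : Measure (EN N))) h
    refine this.congr_fun (fun p _ => hsym p) (MeasurableSet.univ.prod hS)
  have h3 := h.union h2
  rw [integrableOn_iff_integrable_of_support_subset] at h3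
  · exact h3
  · intro p hp
    by_contra hn
    simp only [mem_union, mem_prod, mem_univ, and_true, true_and, not_or] at hn
    exact hp (h0 p hn.1 hn.2)

lemma dist_pow_integrable {N : ℕ} (hN : 2 ≤ N) {r R : ℝ} (h1 : -(N:ℝ) < r) (h2 : r < 0) :
    IntegrableOn (fun p : EN N × EN N => dist p.1 p.2 ^ r) (ball 0 R ×ˢ ball 0 R) := by
  have hb : Integrable (fun y : EN N => (ball (0:EN N) (2*R)).indicator (fun y => ‖y‖^r) y) := by
    have h := (pow_hk_integrable hN h1 h2 one_pos (0:EN N)).const_mul (Real.exp ((2*R)^2))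
    refine Integrable.mono' h (Measurable.aestronglyMeasurable (Measurable.indicator (by fun_prop) measurableSet_ball)) (ae_of_all _ fun y => ?_)
    have q : 0 ≤ hk N 1 (0 - y) := hk_nonneg N zero_le_one _
    by_cases hy : y ∈ ball (0:EN N) (2*R)
    · rw [indicator_of_mem hy, Real.norm_eq_abs, abs_of_nonneg (by positivity)]
      have hy' : ‖y‖ < 2*R := by simpa using hy
      have : 1 ≤ Real.exp ((2*R)^2) * hk N 1 (0-y) := by
        unfold hk
        rw [Real.one_rpow, one_mul, ← Real.exp_add]
        apply Real.one_le_exp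
        have := norm_nonneg y
        simp only [zero_sub, norm_neg, div_one]
        nlinarith
      have hp : 0 ≤ ‖y‖^r := by positivity
      nlinarith
    · rw [indicator_of_notMem hy, norm_zero]; positivity
  have hf : Integrable (fun y : EN N => (ball (0:EN N) R).indicator (fun _ => (1:ℝ)) y) :=
    (integrable_indicator_iff measurableSet_ball).2 (integrableOn_const (by finiteness))
  have h3 := Integrable.convolution_integrand (μ := (volume : Measure (EN N))) (ν := (volume : Measure (EN N)))
    (ContinuousLinearMap.mul ℝ ℝ) hf hb
  have h4 : IntegrableOn _ (ball (0:EN N) R ×ˢ ball (0:EN N) R) (volume.prod volume) := h3.integrableOn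
  refine IntegrableOn.congr_fun h4 (fun p hp => ?_) (measurableSet_ball.prod measurableSet_ball)
  obtain ⟨hp1, hp2⟩ := hp
  simp only [ContinuousLinearMap.mul_apply']
  rw [indicator_of_mem hp2, indicator_of_mem, one_mul, dist_eq_norm]
  simp only [mem_ball, dist_zero_right] at *
  have := norm_sub_le p.1 p.2
  linarith

lemma kernel_far {N : ℕ} {x y : EN N} {a R d : ℝ} (ha : 0 < a) (hR : 0 < R) (hd : 0 < d) (hx : ‖x‖ < R)
    (hxy : d ≤ dist x y) :
    1 / dist x y ^ a ≤ (d⁻¹^a + (R/d+1)^a) * (1 / (1 + ‖y‖^a)) := by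
  have hp : 0 < dist x y := by linarith
  rw [mul_one_div, div_le_div_iff₀ (by positivity) (by positivity), one_mul, add_mul,
    ← Real.mul_rpow (by positivity) hp.le, ← Real.mul_rpow (by positivity) hp.le]
  have h1 : 1 ≤ d⁻¹ * dist x y := by
    rw [inv_mul_eq_div, one_le_div hd]; exact hxy
  have h2 : ‖y‖ ≤ (R/d+1) * dist x y := by
    have e : (R/d+1) * dist x y = R * (d⁻¹ * dist x y) + dist x y := by rw [div_eq_mul_inv]; ring
    rw [e]
    have : ‖y‖ ≤ ‖x‖ + dist x y := by
      rw [dist_eq_norm]; have := norm_sub_norm_le y x; rw [norm_sub_rev] at this; linarith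
    nlinarith
  have h3 := Real.one_le_rpow h1 ha.le
  have h4 : ‖y‖^a ≤ ((R/d+1) * dist x y)^a := by gcongr
  linarith

lemma energyA {N : ℕ} (hN : 2 ≤ N) {s : ℝ} (hs : 0 < s) (hs1 : s < 1) {S T : Set (EN N)}
    (hS : MeasurableSet S) (hT : MeasurableSet T) {R d K : ℝ} (hR : 0 < R) (hd : 0 < d) (hK : 0 ≤ K)
    (hSR : S ⊆ ball 0 R) (hTR : T ⊆ ball 0 R) (hST : ∀ x ∈ S, ∀ y ∉ T, d ≤ dist x y)
    {u v : EN N → ℝ} (hu : MemL1w N s u) (hu2 : IntegrableOn (fun x => (u x)^2) S)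
    (huE : FiniteEnergyOn N s u S T) (hvm : AEStronglyMeasurable v) (hvS : ∀ x ∉ S, v x = 0)
    (hvu : ∀ x, |v x| ≤ |u x|)
    (hvw : ∀ᵐ p : EN N × EN N, p ∈ S ×ˢ T → (v p.1 - v p.2)^2 ≤ 2*(u p.1 - u p.2)^2 + K * dist p.1 p.2^2) :
    Integrable (fun x => v x ^ 2) ∧ Integrable (fun x => v x) ∧ Integrable (fun x => u x * v x) ∧
    Integrable (fun p : EN N × EN N => (v p.1 - v p.2)^2 / dist p.1 p.2 ^ ((N:ℝ)+2*s)) ∧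
    Integrable (fun p : EN N × EN N => (u p.1 - u p.2) * (v p.1 - v p.2) / dist p.1 p.2 ^ ((N:ℝ)+2*s)) := by
  have hum := hu.aesm
  have huS : Integrable (fun x => S.indicator (fun x => (u x)^2) x) := (integrable_indicator_iff hS).2 hu2
  have h1S : Integrable (fun y : EN N => S.indicator (fun _ => (1:ℝ)) y) :=
    (integrable_indicator_iff hS).2 (integrableOn_const ((measure_mono hSR).trans_lt measure_ball_lt_top).ne)
  have iuv : Integrable (fun x => u x * v x) := by
    refine Integrable.mono' huS (hum.mul hvm) (ae_of_all _ fun x => ?_)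
    by_cases hx : x ∈ S
    · rw [indicator_of_mem hx, norm_mul, Real.norm_eq_abs, Real.norm_eq_abs, ← sq_abs, sq]
      exact mul_le_mul_of_nonneg_left (hvu x) (abs_nonneg _)
    · simp [hvS x hx, hx]
  have iv2 : Integrable (fun x => v x ^ 2) := by
    refine Integrable.mono' huS (hvm.pow 2) (ae_of_all _ fun x => ?_)
    by_cases hx : x ∈ S
    · rw [indicator_of_mem hx, norm_pow, Real.norm_eq_abs, ← sq_abs (u x)]
      have := hvu x
      gcongr
    · simp [hvS x hx, hx]
  have iv : Integrable (fun x => v x) := by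
    refine Integrable.mono' (h1S.add iv2) hvm (ae_of_all _ fun x => ?_)
    by_cases hx : x ∈ S
    · simp only [Pi.add_apply, indicator_of_mem hx, Real.norm_eq_abs]
      have := sq_abs (v x)
      nlinarith [sq_nonneg (|v x| - 1), abs_nonneg (v x)]
    · simp [hvS x hx, hx]
  obtain ⟨a, ha⟩ : ∃ a, a = (N:ℝ) + 2*s := ⟨_, rfl⟩
  have hw := weight_integrable (N := N) hs
  unfold FiniteEnergyOn at huE
  unfold MemL1w at hu
  rw [← ha] at hw huE hu ⊢
  have hN' : (2:ℝ) ≤ N := by exact_mod_cast hN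
  have ha0 : 0 < a := by rw [ha]; positivity
  have hu1 : AEStronglyMeasurable (fun p : EN N × EN N => u p.1) (volume.prod volume) :=
    hum.comp_quasiMeasurePreserving Measure.quasiMeasurePreserving_fst
  have hu2' : AEStronglyMeasurable (fun p : EN N × EN N => u p.2) (volume.prod volume) :=
    hum.comp_quasiMeasurePreserving Measure.quasiMeasurePreserving_snd
  have hv1 : AEStronglyMeasurable (fun p : EN N × EN N => v p.1) (volume.prod volume) :=
    hvm.comp_quasiMeasurePreserving Measure.quasiMeasurePreserving_fst
  have hv2 : AEStronglyMeasurable (fun p : EN N × EN N => v p.2) (volume.prod volume) :=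
    hvm.comp_quasiMeasurePreserving Measure.quasiMeasurePreserving_snd
  have hkm : AEStronglyMeasurable (fun p : EN N × EN N => (dist p.1 p.2 ^ a)⁻¹) (volume.prod volume) :=
    Measurable.aestronglyMeasurable (by fun_prop)
  have mV : AEStronglyMeasurable (fun p : EN N × EN N => (v p.1 - v p.2)^2 / dist p.1 p.2 ^ a) (volume.prod volume) := by
    simp_rw [div_eq_mul_inv]
    exact ((hv1.sub hv2).pow 2).mul hkm
  have mU : AEStronglyMeasurable (fun p : EN N × EN N => (u p.1 - u p.2) * (v p.1 - v p.2) / dist p.1 p.2 ^ a) (volume.prod volume) := by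
    simp_rw [div_eq_mul_inv]
    exact ((hu1.sub hu2').mul (hv1.sub hv2)).mul hkm
  -- near part
  have hdist : IntegrableOn (fun p : EN N × EN N => dist p.1 p.2 ^ (2 - a)) (S ×ˢ T) :=
    (dist_pow_integrable hN (R := R) (by rw [ha]; linarith) (by rw [ha]; linarith)).mono_set (prod_mono hSR hTR)
  have dpow : ∀ p : EN N × EN N, dist p.1 p.2^2 / dist p.1 p.2^a = dist p.1 p.2 ^ (2-a) := by
    intro p
    rcases (dist_nonneg (x := p.1) (y := p.2)).eq_or_lt with h | h
    · rw [← h, Real.zero_rpow (x := 2 - a) (by rw [ha]; intro h; linarith)]; simp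
    · rw [Real.rpow_sub h, Real.rpow_two]
  have nearV : IntegrableOn (fun p : EN N × EN N => (v p.1 - v p.2)^2 / dist p.1 p.2 ^ a) (S ×ˢ T) := by
    refine Integrable.mono' ((huE.const_mul 2).add (hdist.const_mul K)) mV.restrict ?_
    rw [ae_restrict_iff' (hS.prod hT)]
    filter_upwards [hvw] with p hp hpm
    simp only [Pi.add_apply]
    rw [Real.norm_eq_abs, abs_of_nonneg (by positivity), ← dpow p, ← mul_div_assoc, ← mul_div_assoc, ← add_div]
    have := hp hpm
    gcongr
  have nearU : IntegrableOn (fun p : EN N × EN N => (u p.1 - u p.2) * (v p.1 - v p.2) / dist p.1 p.2 ^ a) (S ×ˢ T) := by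
    refine Integrable.mono' (huE.add nearV) mU.restrict (ae_of_all _ fun p => ?_)
    simp only [Pi.add_apply]
    rw [Real.norm_eq_abs, abs_div, abs_of_nonneg (a := dist p.1 p.2 ^ a) (by positivity), ← add_div, abs_mul]
    gcongr
    have h1 := sq_abs (u p.1 - u p.2)
    have h2 := sq_abs (v p.1 - v p.2)
    nlinarith [sq_nonneg (|u p.1 - u p.2| - |v p.1 - v p.2|), abs_nonneg (u p.1 - u p.2), abs_nonneg (v p.1 - v p.2)]
  -- far part
  obtain ⟨C, hC⟩ : ∃ C, C = d⁻¹^a + (R/d+1)^a := ⟨_, rfl⟩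
  have far : ∀ p ∈ S ×ˢ Tᶜ, 1 / dist p.1 p.2 ^ a ≤ C * (1 / (1 + ‖p.2‖^a)) := by
    intro p hp
    rw [hC]
    exact kernel_far ha0 hR hd (by simpa using hSR hp.1) (hST _ hp.1 _ hp.2)
  have vT : ∀ p ∈ S ×ˢ Tᶜ, v p.2 = 0 := by
    intro p hp
    refine hvS _ fun h => hp.2 ?_
    by_contra hn
    have := hST _ h _ hn
    rw [dist_self] at this
    linarith
  have farV : IntegrableOn (fun p : EN N × EN N => (v p.1 - v p.2)^2 / dist p.1 p.2 ^ a) (S ×ˢ Tᶜ) := by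
    refine Integrable.mono' ((iv2.mul_prod hw).const_mul C).integrableOn mV.restrict ?_
    rw [ae_restrict_iff' (hS.prod hT.compl)]
    refine ae_of_all _ fun p hp => ?_
    rw [Real.norm_eq_abs, abs_of_nonneg (by positivity), vT p hp, sub_zero, div_eq_mul_one_div]
    have := mul_le_mul_of_nonneg_left (far p hp) (sq_nonneg (v p.1))
    linarith
  have hua : Integrable (fun y => |u y| * (1 / (1 + ‖y‖^a))) := by
    refine hu.abs.congr (ae_of_all _ fun y => ?_)
    simp only
    rw [abs_div, abs_of_nonneg (a := 1 + _) (by positivity), div_eq_mul_one_div]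
  have farU : IntegrableOn (fun p : EN N × EN N => (u p.1 - u p.2) * (v p.1 - v p.2) / dist p.1 p.2 ^ a) (S ×ˢ Tᶜ) := by
    refine Integrable.mono' (((iuv.abs.mul_prod hw).add (iv.abs.mul_prod hua)).const_mul C).integrableOn mU.restrict ?_
    rw [ae_restrict_iff' (hS.prod hT.compl)]
    refine ae_of_all _ fun p hp => ?_
    rw [Real.norm_eq_abs, abs_div, abs_of_nonneg (a := dist p.1 p.2 ^ a) (by positivity), vT p hp, sub_zero, div_eq_mul_one_div]
    have h1 := mul_le_mul_of_nonneg_left (far p hp) (abs_nonneg ((u p.1 - u p.2) * v p.1))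
    refine h1.trans ?_
    have hC0 : 0 ≤ C := by rw [hC]; positivity
    have h2 : |(u p.1 - u p.2) * v p.1| ≤ |u p.1 * v p.1| + |v p.1| * |u p.2| := by
      rw [sub_mul, ← abs_mul (v p.1), mul_comm (v p.1)]
      exact abs_sub _ _
    have h3 : 0 ≤ C * (1 / (1 + ‖p.2‖^a)) := by positivity
    have h4 := mul_le_mul_of_nonneg_right h2 h3
    refine h4.trans (le_of_eq ?_)
    simp only [Pi.add_apply]
    ring
  have uni : S ×ˢ (univ : Set (EN N)) = S ×ˢ T ∪ S ×ˢ Tᶜ := by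
    rw [← prod_union, union_compl_self]
  refine ⟨iv2, iv, iuv, sym_ext hS (fun p => ?_) (fun p h1 h2 => ?_) ?_, sym_ext hS (fun p => ?_) (fun p h1 h2 => ?_) ?_⟩
  · simp only [Prod.fst_swap, Prod.snd_swap]; rw [dist_comm]; ring
  · simp [hvS _ h1, hvS _ h2]
  · rw [uni]; exact nearV.union farV
  · simp only [Prod.fst_swap, Prod.snd_swap]; rw [dist_comm]; ring
  · simp [hvS _ h1, hvS _ h2]
  · rw [uni]; exact nearU.union farU

/-- The function `g = ε v + v²/Ψ`, pointwise. -/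
def gf (ε v p : ℝ) : ℝ := ε * v + v^2 / p

lemma alg_uv {ε u v p : ℝ} (hp : v ≠ 0 → 0 < p) (hv : v ≠ 0 → v = max (-(u + ε*p)) 0) :
    u * v = -(gf ε v p * p) := by
  unfold gf
  by_cases h : v = 0
  · simp [h]
  · have hp := hp h
    have hv := hv h
    have : v = -(u+ε*p) := by
      rcases max_choice (-(u + ε*p)) 0 with h1 | h1
      · rw [hv, h1]
      · exact absurd (hv.trans h1) h
    have e : u = -v - ε*p := by linarith
    rw [e]; field_simp; ring

lemma alg_P {ε ux vx px uy vy py : ℝ} (hx : ux * vx = -(gf ε vx px * px))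
    (hy : uy * vy = -(gf ε vy py * py)) :
    -((ux - uy) * (vx - vy)) - (px - py) * (gf ε vx px - gf ε vy py) =
      vx * ((uy + ε * py) + py * (vx / px)) + vy * ((ux + ε * px) + px * (vy / py)) := by
  have e1 : gf ε vx px * py = vx * (ε*py + py * (vx/px)) := by unfold gf; ring
  have e2 : gf ε vy py * px = vy * (ε*px + px * (vy/py)) := by unfold gf; ring
  linear_combination -hx - hy + e1 + e2

lemma alg_nonneg {ε ux vx px uy vy py : ℝ} (hpx0 : 0 ≤ px) (hpy0 : 0 ≤ py) (hpx : vx ≠ 0 → 0 < px)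
    (hpy : vy ≠ 0 → 0 < py) (hx : vx = max (-(ux + ε*px)) 0) (hy : vy = max (-(uy + ε*py)) 0) :
    0 ≤ vx * ((uy + ε * py) + py * (vx / px)) + vy * ((ux + ε * px) + px * (vy / py)) := by
  have hx1 : -(ux + ε*px) ≤ vx := hx ▸ le_max_left _ _
  have hy1 : -(uy + ε*py) ≤ vy := hy ▸ le_max_left _ _
  have hx0 : 0 ≤ vx := hx ▸ le_max_right _ _
  have hy0 : 0 ≤ vy := hy ▸ le_max_right _ _
  by_cases h1 : vx = 0
  · rw [h1] at hx1 ⊢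
    have : 0 ≤ ux + ε*px := by linarith
    simp only [zero_mul, zero_add]
    positivity
  by_cases h2 : vy = 0
  · rw [h2] at hy1 ⊢
    have : 0 ≤ uy + ε*py := by linarith
    simp only [zero_mul, add_zero]
    positivity
  have p1 := hpx h1
  have p2 := hpy h2
  have q1 : vx * (-vy + py * (vx/px)) + vy * (-vx + px * (vy/py)) = (py*vx - px*vy)^2/(px*py) := by
    field_simp; ring
  have q2 : 0 ≤ (py*vx - px*vy)^2/(px*py) := by positivity
  have q3 := mul_le_mul_of_nonneg_left hy1 hx0
  have q4 := mul_le_mul_of_nonneg_left hx1 hy0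
  linarith

lemma per_eps (N : ℕ) (hN : 2 ≤ N) (s : ℝ) (hs : 0 < s) (hs1 : s < 1)
    (μ τm : ℝ) (Ω : Set (EN N)) (hΩ : IsBoundedDomain N Ω) (h0 : (0:EN N) ∈ Ω)
    (u : EN N → ℝ) (hu : MemWsStar N s Ω u)
    (hsuper : ∀ v : EN N → ℝ, MemHs0 N s Ω v → (∀ x, 0 ≤ v x) →
      (∃ δ : ℝ, 0 < δ ∧ ∀ x ∈ ball (0:EN N) δ, v x = 0) → 0 ≤ Esmu N s μ u v)
    (hout : ∀ᵐ x : EN N, x ∉ Ω → 0 ≤ u x)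
    (hliminf : ∀ ε : ℝ, 0 < ε →
      ∀ᶠ x in 𝓝[≠] (0:EN N), -ε ≤ u x / Phi N s μ τm x)
    {Ψ : EN N → ℝ} (hΨ : SuperSol N s μ τm Ω Ψ) {ε : ℝ} (hε : 0 < ε) :
    ∀ᵐ x : EN N, 0 ≤ u x + ε * Ψ x := by
  obtain ⟨hΩo, -, hΩb⟩ := hΩ
  have hΨm := hΨ.meas
  -- nonnegativity near the origin
  obtain ⟨δ, hδ, hδw⟩ : ∃ δ : ℝ, 0 < δ ∧ ∀ x : EN N, ‖x‖ < δ → x ≠ 0 → 0 ≤ u x + ε * Ψ x ∧ 0 < Ψ x := by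
    obtain ⟨K, hK, hnear⟩ := hΨ.near
    have h1 := hliminf (ε/K) (by positivity)
    have h2 : ∀ᶠ x in 𝓝[≠] (0:EN N), 0 ≤ u x + ε * Ψ x ∧ 0 < Ψ x := by
      filter_upwards [hnear, h1] with x hx hx1
      obtain ⟨a1, a2⟩ := hx
      rw [le_div_iff₀ a1] at hx1
      have a3 : ε/K * Phi N s μ τm x ≤ ε/K * (K * Ψ x) := by gcongr
      have a4 : ε/K * (K * Ψ x) = ε * Ψ x := by field_simp
      refine ⟨by linarith, ?_⟩
      have : 0 < K * Ψ x := by linarith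
      exact pos_of_mul_pos_right this hK.le
    rw [eventually_nhdsWithin_iff, Metric.eventually_nhds_iff] at h2
    obtain ⟨δ, hδ, h⟩ := h2
    exact ⟨δ, hδ, fun x hx hne => h (by simpa using hx) hne⟩
  obtain ⟨S, hSd⟩ : ∃ S, S = Ω \ ball (0:EN N) δ := ⟨_, rfl⟩
  have hSm : MeasurableSet S := by rw [hSd]; exact hΩo.measurableSet.diff measurableSet_ball
  have hSΩ : S ⊆ Ω := by rw [hSd]; exact diff_subset
  have hSn : ∀ x ∈ S, δ ≤ ‖x‖ := by
    intro x hx; rw [hSd] at hx; simpa using hx.2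
  obtain ⟨R, hΩR, hlip⟩ := hΨ.lip
  have hR : 0 < R := by
    have := hΩR (subset_closure h0)
    simpa using this
  obtain ⟨L, hL0, hL⟩ := hlip (δ/2) (by positivity)
  obtain ⟨hu1, hu2, Ω', hΩ'o, -, hΩ'c, huE⟩ := hu.2 (δ/2) (by positivity)
  have hSA : S ⊆ Ω \ closedBall 0 (δ/2) := by
    intro x hx
    refine ⟨hSΩ hx, ?_⟩
    have := hSn x hx
    simp only [mem_closedBall, dist_zero_right, not_le]; linarith
  obtain ⟨T, hTd⟩ : ∃ T, T = (Ω' ∩ ball (0:EN N) R) \ closedBall 0 (δ/2) := ⟨_, rfl⟩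
  have hTo : IsOpen T := by
    rw [hTd]; exact (hΩ'o.inter isOpen_ball).sdiff isClosed_closedBall
  have hST : closure S ⊆ T := by
    intro x hx
    rw [hTd]
    refine ⟨⟨hΩ'c (closure_mono hSA hx), hΩR (closure_mono hSΩ hx)⟩, ?_⟩
    have hc : IsClosed {x : EN N | δ ≤ ‖x‖} := isClosed_le continuous_const continuous_norm
    have := closure_minimal (show S ⊆ {x : EN N | δ ≤ ‖x‖} from hSn) hc hx
    simp only [mem_setOf_eq] at this
    simp only [mem_closedBall, dist_zero_right, not_le]; linarith
  have hSb : Bornology.IsBounded S := hΩb.subset hSΩ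
  obtain ⟨d, hd, hdT⟩ := hSb.isCompact_closure.exists_thickening_subset_open hTo hST
  have hdist : ∀ x ∈ S, ∀ y ∉ T, d ≤ dist x y := by
    intro x hx y hy
    by_contra hcon
    push Not at hcon
    refine hy (hdT (mem_thickening_iff.2 ⟨x, subset_closure hx, ?_⟩))
    rwa [dist_comm]
  have hSR : S ⊆ ball 0 R := fun x hx => hΩR (subset_closure (hSΩ hx))
  have hTR : T ⊆ ball 0 R := by rw [hTd]; exact fun x hx => hx.1.2
  have hTn : ∀ x ∈ T, δ/2 ≤ ‖x‖ := by
    intro x hx; rw [hTd] at hx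
    have := hx.2
    simp only [mem_closedBall, dist_zero_right, not_le] at this
    exact this.le
  -- the test function
  obtain ⟨v, hvd⟩ : ∃ v : EN N → ℝ, v = S.indicator (fun x => max (-(u x + ε * Ψ x)) 0) := ⟨_, rfl⟩
  have hum := hu1.aesm
  have hvm : AEStronglyMeasurable v := by
    rw [hvd]
    refine AEStronglyMeasurable.indicator ?_ hSm
    exact ((hum.add (hΨm.aestronglyMeasurable.const_mul ε)).neg).sup aestronglyMeasurable_const
  have hvS : ∀ x ∉ S, v x = 0 := fun x hx => by rw [hvd, indicator_of_notMem hx]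
  have hvin : ∀ x ∈ S, v x = max (-(u x + ε * Ψ x)) 0 := fun x hx => by rw [hvd, indicator_of_mem hx]
  have hv0 : ∀ x, 0 ≤ v x := by
    intro x
    by_cases hx : x ∈ S
    · rw [hvin x hx]; exact le_max_right _ _
    · rw [hvS x hx]
  have hvne : ∀ x, v x ≠ 0 → x ∈ S := fun x h => by
    by_contra hx; exact h (hvS x hx)
  have hΨ0 := hΨ.nonneg
  have hΨp : ∀ x, v x ≠ 0 → 0 < Ψ x := by
    intro x h
    obtain ⟨c, hc, hcl⟩ := hΨ.lower δ hδ
    exact hc.trans_le (hcl x (hSΩ (hvne x h)) (hSn x (hvne x h)))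
  have hvw : ∀ᵐ x : EN N, v x = max (-(u x + ε * Ψ x)) 0 := by
    filter_upwards [hout, ae_ne_zero_EN hN] with x h1 h2
    by_cases hx : x ∈ S
    · exact hvin x hx
    · rw [hvS x hx]
      symm
      rw [max_eq_right_iff]
      by_cases hxΩ : x ∈ Ω
      · have : ‖x‖ < δ := by
          by_contra hn
          refine hx ?_
          rw [hSd]
          exact ⟨hxΩ, by simpa using hn⟩
        linarith [(hδw x this h2).1]
      · have := h1 hxΩ
        have := mul_nonneg hε.le (hΨ0 x)
        linarith
  have hvu : ∀ x, |v x| ≤ |u x| := by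
    intro x
    rw [abs_of_nonneg (hv0 x)]
    by_cases hx : x ∈ S
    · rw [hvin x hx]
      have := mul_nonneg hε.le (hΨ0 x)
      exact max_le (by linarith [neg_le_abs (u x)]) (abs_nonneg _)
    · rw [hvS x hx]; exact abs_nonneg _
  have hvw1 : ∀ᵐ p : EN N × EN N, v p.1 = max (-(u p.1 + ε * Ψ p.1)) 0 :=
    Measure.quasiMeasurePreserving_fst.ae hvw
  have hvw2 : ∀ᵐ p : EN N × EN N, v p.2 = max (-(u p.2 + ε * Ψ p.2)) 0 :=
    Measure.quasiMeasurePreserving_snd.ae hvw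
  obtain ⟨iv2, iv, iuv, iV, iU⟩ := energyA hN hs hs1 (K := 2*(ε*L)^2) hSm hTo.measurableSet hR hd (by positivity) hSR hTR hdist hu1
    (hu2.mono_set hSA)
    (IntegrableOn.mono_set huE (prod_mono hSA (by rw [hTd]; exact fun x hx => hx.1.1))) hvm hvS hvu (by
      filter_upwards [hvw1, hvw2] with p h1 h2 hp
      have hΨl : |Ψ p.1 - Ψ p.2| ≤ L * dist p.1 p.2 :=
        hL _ _ (by linarith [hSn _ hp.1]) (by simpa using hSR hp.1) (hTn _ hp.2) (by simpa using hTR hp.2)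
      have a1 : |v p.1 - v p.2| ≤ |(u p.1 - u p.2) + ε * (Ψ p.1 - Ψ p.2)| := by
        rw [h1, h2]
        refine (abs_max_sub_max_le_abs _ _ _).trans (le_of_eq ?_)
        rw [← abs_neg]; congr 1; ring
      have a2 := sq_le_sq' (by linarith [abs_nonneg (v p.1 - v p.2), abs_nonneg ((u p.1 - u p.2) + ε * (Ψ p.1 - Ψ p.2))]) a1
      rw [sq_abs, sq_abs] at a2
      have a3 := pow_le_pow_left₀ (abs_nonneg _) hΨl 2
      rw [sq_abs] at a3
      have a4 := mul_le_mul_of_nonneg_left a3 (sq_nonneg ε)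
      have e4 : ε^2 * (L * dist p.1 p.2)^2 = (ε*L)^2 * dist p.1 p.2^2 := by ring
      rw [e4] at a4
      generalize (ε*L)^2 * dist p.1 p.2^2 = Z at *
      nlinarith [sq_nonneg ((u p.1 - u p.2) - ε * (Ψ p.1 - Ψ p.2))])
  have hMem : MemHs0 N s Ω v := by
    refine ⟨⟨fun K _ => iv2.integrableOn, iV.integrableOn⟩, ae_of_all _ fun x hx => hvS x fun h => hx (hSΩ h)⟩
  have hE := hsuper v hMem hv0 ⟨δ, hδ, fun x hx => hvS x (by rw [hSd]; exact fun h => h.2 hx)⟩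
  have huvg : ∀ x, u x * v x = -(gf ε (v x) (Ψ x) * Ψ x) := fun x =>
    alg_uv (hΨp x) (fun h => hvin x (hvne x h))
  have hg : Integrable (fun x => gf ε (v x) (Ψ x)) := by
    obtain ⟨c, hc, hcl⟩ := hΨ.lower δ hδ
    have h2 : Integrable (fun x => v x ^2 / Ψ x) := by
      refine Integrable.mono' (iv2.div_const c) ?_ (ae_of_all _ fun x => ?_)
      · simp_rw [div_eq_mul_inv]
        exact (hvm.pow 2).mul hΨm.inv.aestronglyMeasurable
      · have := hΨ0 x
        rw [Real.norm_eq_abs, abs_of_nonneg (by positivity)]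
        by_cases h : v x = 0
        · simp [h]
        · have := hcl x (hSΩ (hvne x h)) (hSn x (hvne x h))
          gcongr
    exact (iv.const_mul ε).add h2
  have hg0 : ∀ x, 0 ≤ gf ε (v x) (Ψ x) := by
    intro x
    have := hΨ0 x
    have := hv0 x
    unfold gf; positivity
  have hgS : ∀ x, gf ε (v x) (Ψ x) ≠ 0 → x ∈ Ω ∧ δ ≤ ‖x‖ := by
    intro x h
    have : v x ≠ 0 := by
      intro h'; apply h; simp [gf, h']
    exact ⟨hSΩ (hvne x this), hSn x (hvne x this)⟩
  have hPe := fun p : EN N × EN N => alg_P (huvg p.1) (huvg p.2)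
  have hzero := mainB hN hs hs1 hΨ hδ hg hg0 hgS (F := fun p => (u p.1 - u p.2) * (v p.1 - v p.2)) iU (by
      filter_upwards [hvw1, hvw2] with p h1 h2
      rw [hPe p]
      exact alg_nonneg (hΨ0 _) (hΨ0 _) (hΨp _) (hΨp _) h1 h2) (by
      unfold Esmu Es at hE
      refine hE.trans (le_of_eq ?_)
      have : ∫ x, u x * v x / ‖x‖^(2*s) = -∫ x, gf ε (v x) (Ψ x) * (Ψ x / ‖x‖^(2*s)) := by
        rw [← integral_neg]
        congr 1; ext x
        rw [huvg x]; ring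
      rw [this]; ring)
  simp_rw [hPe] at hzero
  have hzero' := Measure.ae_ae_of_ae_prod hzero
  filter_upwards [hzero', hvw] with x hx hxv
  by_contra hneg
  push Not at hneg
  have hvpos : 0 < v x := by
    rw [hxv]; exact lt_max_of_lt_left (by linarith)
  have hxp := hΨp x hvpos.ne'
  have hfr : ∃ y ∈ ball (0:EN N) δ, y ≠ 0 ∧ v x * ((u y + ε * Ψ y) + Ψ y * (v x / Ψ x)) + v y * ((u x + ε * Ψ x) + Ψ x * (v y / Ψ y)) = 0 := by
    have hb : (ae (volume.restrict (ball (0:EN N) δ))).NeBot := by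
      rw [ae_neBot, Ne, Measure.restrict_eq_zero]
      exact (measure_ball_pos _ _ hδ).ne'
    have h1 := ae_restrict_of_ae (s := ball (0:EN N) δ) hx
    have h2 := ae_restrict_of_ae (s := ball (0:EN N) δ) (ae_ne_zero_EN hN)
    obtain ⟨y, ⟨a, b⟩, c⟩ := ((h1.and h2).and (ae_restrict_mem measurableSet_ball)).exists
    exact ⟨y, c, b, a⟩
  obtain ⟨y, hy, hyne, heq⟩ := hfr
  have hvy : v y = 0 := hvS y (by rw [hSd]; exact fun h => h.2 hy)
  obtain ⟨b1, b2⟩ := hδw y (by simpa using hy) hyne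
  rw [hvy] at heq
  have : 0 < v x * ((u y + ε * Ψ y) + Ψ y * (v x / Ψ x)) := by positivity
  linarith

/-- Lemma 4.7 (comparison principle, version 2): if `u ∈ W^s_*(Ω)`
satisfies `L^s_μ u ≥ 0` in `Ω \ {0}` weakly, `u ≥ 0` outside `Ω` and
`liminf_{x→0} u(x)/Φ_μ(x) ≥ 0`, then `u ≥ 0` a.e. in `ℝ^N`. -/
theorem comparison_principle_v2
    (N : ℕ) (hN : 2 ≤ N) (s : ℝ) (hs : s ∈ Ioo (0:ℝ) 1)
    (μ τm : ℝ) (hμ : mu0 N s ≤ μ)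
    (hτm : τm ∈ Ioc (-(N:ℝ)) ((2*s - N)/2)) (hτmc : csFun N s τm = -μ)
    (Ω : Set (EN N)) (hΩ : IsBoundedDomain N Ω) (h0 : (0:EN N) ∈ Ω)
    (u : EN N → ℝ) (hu : MemWsStar N s Ω u)
    (hsuper : ∀ v : EN N → ℝ, MemHs0 N s Ω v → (∀ x, 0 ≤ v x) →
      (∃ δ : ℝ, 0 < δ ∧ ∀ x ∈ ball (0:EN N) δ, v x = 0) → 0 ≤ Esmu N s μ u v)
    (hout : ∀ᵐ x : EN N, x ∉ Ω → 0 ≤ u x)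
    (hliminf : ∀ ε : ℝ, 0 < ε →
      ∀ᶠ x in 𝓝[≠] (0:EN N), -ε ≤ u x / Phi N s μ τm x) :
    ∀ᵐ x : EN N, 0 ≤ u x := by
  obtain ⟨Ψ, hΨ⟩ := exists_superSol hN hs.1 hs.2 hτm hτmc hΩ.2.2
  have h := fun n : ℕ => per_eps N hN s hs.1 hs.2 μ τm Ω hΩ h0 u hu hsuper hout hliminf hΨ
    (ε := 1 / ((n:ℝ) + 1)) (by positivity)
  filter_upwards [ae_all_iff.2 h] with x hx
  have ht : Tendsto (fun n : ℕ => u x + 1 / ((n:ℝ) + 1) * Ψ x) atTop (𝓝 (u x + 0 * Ψ x)) :=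
    tendsto_const_nhds.add (tendsto_one_div_add_atTop_nhds_zero_nat.mul_const _)
  have := ge_of_tendsto' ht hx
  linarith
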